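/- arXiv:2203.11017 — 3 statements merged into one kernel-verified Lean document; each statement's English description precedes it below -/
import Mathlib

section
/- Let {a, b} be a 2-element generating set of a finite abelian group G with a ≠ 0 and b ≠ 0. If [G : ⟨a⟩] ≥ 600 or [G : ⟨b⟩] ≥ 600, then Cay(G; a, b) has two arc-disjoint hamiltonian paths. -/
/-- The arc set of a path `v : Fin N → G`: the pairs `(v i, v (i+1))`. -/
def ArcSet {G : Type*} (N : ℕ) (v : Fin N → G) : Set (G × G) :=
  {p | ∃ (i : ℕ) (h : i + 1 < N), p = (v ⟨i, Nat.lt_of_succ_lt h⟩, v ⟨i + 1, h⟩)}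

/-- `v : Fin N → G` is a hamiltonian path of the Cayley digraph `Cay(G; a, b)`. -/
def IsHamPath {G : Type*} [AddCommGroup G] (a b : G) (N : ℕ) (v : Fin N → G) : Prop :=
  Function.Bijective v ∧
    ∀ (i : ℕ) (h : i + 1 < N),
      v ⟨i + 1, h⟩ - v ⟨i, Nat.lt_of_succ_lt h⟩ ∈ ({a, b} : Set G)

/-- The first-return map of a spanning quasi-path to a coset of `⟨b - a⟩`, lifted to `ℤ`:
residues at most `A` are translated by `q`, the others by `q + 1`. -/
def returnStep (h q A x : ℤ) : ℤ := if x % h ≤ A then x + q else x + q + 1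

/-- The forward orbit of `x` under `returnStep h q A` meets the multiples of `h`. -/
def Reaches (h q A x : ℤ) : Prop := ∃ n : ℕ, h ∣ (returnStep h q A)^[n] x

/-- Every orbit of `returnStep h q A` meets the multiples of `h`. -/
def Absorbing (h q A : ℤ) : Prop := ∀ x, Reaches h q A x

/-- A periodic set of integers that is a single cycle of `returnStep h q A` modulo `h`. -/
structure IsReturnCycle (h q A : ℤ) (C : Set ℤ) : Prop where
  periodic : ∀ x ∈ C, ∀ k, x + h * k ∈ C
  zero_notMem : (0 : ℤ) ∉ C
  maps : ∀ x ∈ C, returnStep h q A x ∈ C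
  trans : ∀ x ∈ C, ∀ y ∈ C, ∃ n : ℕ, h ∣ (returnStep h q A)^[n] x - y

section ReturnStep

variable {h q A : ℤ}

lemma emod_eq_sub {x k : ℤ} (h0 : h * k ≤ x) (h1 : x < h * k + h) : x % h = x - h * k := by
  have : (x - h * k) % h = x - h * k := Int.emod_eq_of_lt (by linarith) (by linarith)
  rw [← this]; simp [Int.sub_emod]

lemma exists_block (hh : 0 < h) {x : ℤ} (hx : ¬ h ∣ x) :
    ∃ k, h * k < x ∧ x < h * k + h := by
  refine ⟨x / h, ?_, Int.lt_mul_ediv_self_add hh⟩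
  rcases (Int.mul_ediv_self_le (x := x) hh.ne').lt_or_eq with H | H
  · exact H
  · exact absurd ⟨x / h, H.symm⟩ hx

lemma not_dvd_of_block (hh : 0 < h) {x k : ℤ} (h0 : h * k < x) (h1 : x < h * k + h) :
    ¬ h ∣ x := by
  rintro ⟨l, rfl⟩
  have h2 : k < l := lt_of_mul_lt_mul_left h0 hh.le
  have h3 : l < k + 1 := lt_of_mul_lt_mul_left (by linarith) hh.le
  omega

lemma returnStep_low (hA : A < h) {x k : ℤ} (h0 : h * k ≤ x) (h1 : x ≤ h * k + A) :
    returnStep h q A x = x + q := by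
  unfold returnStep
  rw [emod_eq_sub h0 (by linarith), if_pos (by linarith)]

lemma returnStep_high {x k : ℤ} (hA : 0 ≤ A) (h0 : h * k + A < x) (h1 : x < h * k + h) :
    returnStep h q A x = x + q + 1 := by
  unfold returnStep
  rw [emod_eq_sub (by linarith) h1, if_neg (by linarith)]

lemma returnStep_add (x k : ℤ) :
    returnStep h q A (x + h * k) = returnStep h q A x + h * k := by
  unfold returnStep
  rw [Int.add_mul_emod_self_left]
  split_ifs <;> ring

lemma iterate_returnStep_add (n : ℕ) (x k : ℤ) :
    (returnStep h q A)^[n] (x + h * k) = (returnStep h q A)^[n] x + h * k := by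
  induction n generalizing x with
  | zero => rfl
  | succ n ih => rw [Function.iterate_succ_apply, returnStep_add, ih, Function.iterate_succ_apply]

lemma reaches_of_dvd {x : ℤ} (hx : h ∣ x) : Reaches h q A x := ⟨0, hx⟩

lemma reaches_of_step {x y : ℤ} (e : returnStep h q A x = y) (H : Reaches h q A y) :
    Reaches h q A x := by
  obtain ⟨n, hn⟩ := H
  exact ⟨n + 1, by rwa [Function.iterate_succ_apply, e]⟩

lemma Reaches.congr {x y : ℤ} (H : Reaches h q A x) (e : h ∣ y - x) : Reaches h q A y := by
  obtain ⟨n, hn⟩ := H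
  obtain ⟨k, hk⟩ := e
  obtain rfl : y = x + h * k := by linarith
  exact ⟨n, by rw [iterate_returnStep_add]; exact dvd_add hn (dvd_mul_right _ _)⟩

lemma returnStep_lt (hh : 0 < h) {x y : ℤ} (hx : ¬ h ∣ x)
    (hy : ¬ h ∣ y) (hxy : x < y) : returnStep h q A x < returnStep h q A y := by
  have h1 : ∀ z, z + q ≤ returnStep h q A z ∧ returnStep h q A z ≤ z + q + 1 := by
    intro z; unfold returnStep; split_ifs <;> constructor <;> linarith
  rcases (show x + 2 ≤ y ∨ y = x + 1 by omega) with H | rfl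
  · linarith [(h1 x).2, (h1 y).1]
  · obtain ⟨k, hk, hk'⟩ := exists_block hh hx
    have h2 : x + 1 < h * k + h := by
      rcases (show x + 1 < h * k + h ∨ x + 1 = h * k + h by omega) with H | H
      · exact H
      · exact absurd ⟨k + 1, by linarith⟩ hy
    unfold returnStep
    rw [emod_eq_sub (k := k) hk.le hk', emod_eq_sub (k := k) (by linarith) h2]
    split_ifs <;> linarith

lemma returnStep_neg (hh : 0 < h) (hA : 0 ≤ A) (hA' : A < h) {x : ℤ} (hx : ¬ h ∣ x) :
    returnStep h (-q - 1) (h - 1 - A) (-x) = -returnStep h q A x := by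
  obtain ⟨k, hk, hk'⟩ := exists_block hh hx
  rcases le_or_gt x (h * k + A) with H | H
  · rw [returnStep_low hA' hk.le H, returnStep_high (k := -k - 1) (by linarith) (by linarith)
      (by linarith)]
    ring
  · rw [returnStep_high hA H hk', returnStep_low (k := -k - 1) (by linarith) (by linarith)
      (by linarith)]
    ring

lemma Absorbing.neg (hh : 0 < h) (hA : 0 ≤ A) (hA' : A < h) (H : Absorbing h q A) :
    Absorbing h (-q - 1) (h - 1 - A) := by
  suffices ∀ (n : ℕ) (x : ℤ), h ∣ (returnStep h q A)^[n] x →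
      Reaches h (-q - 1) (h - 1 - A) (-x) by
    intro x
    obtain ⟨n, hn⟩ := H (-x)
    simpa using this n (-x) hn
  intro n
  induction n with
  | zero => intro x hx; exact reaches_of_dvd (by simpa using hx)
  | succ n ih =>
    intro x hx
    by_cases hd : h ∣ x
    · exact reaches_of_dvd (by simpa using hd)
    · rw [Function.iterate_succ_apply] at hx
      exact reaches_of_step (returnStep_neg hh hA hA' hd) (ih _ hx)

lemma exists_mul_add (hh : 0 < h) {x y : ℤ} (hd : (Int.gcd q h : ℤ) ∣ y - x) :
    ∃ (n : ℕ) (k : ℤ), y = x + n * q + h * k := by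
  obtain ⟨e, he⟩ := hd
  have hb := Int.gcd_eq_gcd_ab q h
  set u := Int.gcdA q h
  set v := Int.gcdB q h
  refine ⟨((u * e) % h).toNat, q * ((u * e) / h) + v * e, ?_⟩
  rw [Int.toNat_of_nonneg (Int.emod_nonneg _ hh.ne')]
  have h1 := Int.emod_add_mul_ediv (u * e) h
  rw [hb] at he
  have h2 : q * (u * e) = q * ((u * e) % h + h * ((u * e) / h)) := by rw [h1]
  linear_combination he + h2

end ReturnStep

namespace IsReturnCycle

variable {h q A : ℤ} {C : Set ℤ}

lemma mem_congr (hC : IsReturnCycle h q A C) {x y : ℤ} (hx : x ∈ C) (e : h ∣ y - x) :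
    y ∈ C := by
  obtain ⟨k, hk⟩ := e
  obtain rfl : y = x + h * k := by linarith
  exact hC.periodic x hx k

lemma not_dvd (hC : IsReturnCycle h q A C) {x : ℤ} (hx : x ∈ C) : ¬ h ∣ x := fun hd =>
  hC.zero_notMem (hC.mem_congr hx (by simpa using hd))

lemma iterate_mem (hC : IsReturnCycle h q A C) {x : ℤ} (hx : x ∈ C) (n : ℕ) :
    (returnStep h q A)^[n] x ∈ C := by
  induction n with
  | zero => exact hx
  | succ n ih => rw [Function.iterate_succ_apply']; exact hC.maps _ ih

lemma exists_preimage (hC : IsReturnCycle h q A C) {y : ℤ} (hy : y ∈ C) :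
    ∃ x ∈ C, returnStep h q A x = y := by
  obtain ⟨n, k, hk⟩ := hC.trans _ (hC.maps y hy) y hy
  refine ⟨(returnStep h q A)^[n] y + h * (-k), hC.periodic _ (hC.iterate_mem hy n) _, ?_⟩
  have e := Function.iterate_succ_apply' (returnStep h q A) n y
  rw [Function.iterate_succ_apply] at e
  rw [returnStep_add, ← e]
  linarith

lemma returnStep_notMem (hh : 0 < h) (hC : IsReturnCycle h q A C) {x : ℤ} (hx : ¬ h ∣ x)
    (hxC : x ∉ C) : returnStep h q A x ∉ C := by
  intro H
  obtain ⟨y, hy, e⟩ := hC.exists_preimage H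
  rcases lt_trichotomy x y with H | H | H
  · exact (returnStep_lt hh hx (hC.not_dvd hy) H).ne e.symm
  · exact hxC (H ▸ hy)
  · exact (returnStep_lt hh (hC.not_dvd hy) hx H).ne e

end IsReturnCycle

namespace IsReturnCycle

variable {h q A B G : ℤ} {C : Set ℤ}

/-- A path along a return cycle from `x` to `y` meeting neither `y` before its end nor `w`,
provided `w` is the predecessor of `x`, all modulo `h`. -/
lemma propagate (hC : IsReturnCycle h q A C) {w y : ℤ} (hw : w ∈ C) (hy : y ∈ C)
    (P : ℤ → Prop) (hP : ∀ x y, h ∣ y - x → P x → P y)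
    (step : ∀ z ∈ C, ¬ h ∣ z - w → ¬ h ∣ z - y → P (returnStep h q A z) → P z) (hPy : P y) :
    P (returnStep h q A w) := by
  classical
  have hex : ∃ n, h ∣ (returnStep h q A)^[n] (returnStep h q A w) - y :=
    hC.trans _ (hC.maps w hw) y hy
  have key : ∀ n, n ≤ Nat.find hex →
      P ((returnStep h q A)^[Nat.find hex - n] (returnStep h q A w)) := by
    intro n
    induction n with
    | zero =>
      intro _
      obtain ⟨k, hk⟩ := Nat.find_spec hex
      exact hP y _ ⟨k, hk⟩ hPy
    | succ n ih =>
      intro hn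
      set m := Nat.find hex - (n + 1) with hm
      have hm1 : Nat.find hex - n = m + 1 := by omega
      have hlt : m < Nat.find hex := by omega
      have ih' := ih (by omega)
      rw [hm1, Function.iterate_succ_apply'] at ih'
      refine step _ (hC.iterate_mem (hC.maps w hw) m) ?_ (Nat.find_min hex hlt) ih'
      rintro ⟨k, hk⟩
      have e : (returnStep h q A)^[m] (returnStep h q A w) = w + h * k := by linarith
      have e' : (returnStep h q A)^[m + 1] (returnStep h q A w) = returnStep h q A w + h * k := by
        rw [Function.iterate_succ_apply', e, returnStep_add]
      have hfin := Nat.find_spec hex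
      obtain ⟨r, hr⟩ : ∃ r, Nat.find hex = r + (m + 1) := ⟨n, by omega⟩
      rw [hr, Function.iterate_add_apply, e', iterate_returnStep_add] at hfin
      have hr' : h ∣ (returnStep h q A)^[r] (returnStep h q A w) - y := by
        have := dvd_sub hfin (dvd_mul_right h k)
        rwa [add_sub_right_comm, add_sub_cancel_right] at this
      exact Nat.find_min hex (by omega) hr'
  simpa using key (Nat.find hex) le_rfl

/-- `z - i` lies weakly below `z ∈ C` with no element of `C` in between. -/
def Label (C : Set ℤ) (z : ℤ) (i : ℕ) : Prop := z ∈ C ∧ ∀ t : ℕ, 0 < t → t ≤ i → z - t ∉ C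

lemma Label.mono {z : ℤ} {i i' : ℕ} (H : Label C z i) (hi : i' ≤ i) : Label C z i' :=
  ⟨H.1, fun t ht ht' => H.2 t ht (ht'.trans hi)⟩

lemma Label.lt {z w : ℤ} {i : ℕ} (H : Label C z i) (hw : w ∈ C) (hwz : w < z) : w < z - i := by
  by_contra hlt
  refine H.2 (z - w).toNat (by omega) (by omega) ?_
  rwa [Int.toNat_of_nonneg (by omega), sub_sub_cancel]

lemma label_congr (hC : IsReturnCycle h q A C) {z w : ℤ} {i : ℕ} (e : h ∣ w - z)
    (H : Label C z i) : Label C w i :=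
  ⟨hC.mem_congr H.1 e, fun t ht hti hm => H.2 t ht hti <| hC.mem_congr hm <| by
    rwa [← dvd_neg, show -(z - t - (w - t)) = w - z by ring]⟩

lemma exists_label (hh : 0 < h) (hC : IsReturnCycle h q A C) {w : ℤ} (hw : w ∈ C) (x : ℤ) :
    ∃ z i, Label C z i ∧ x = z - (i : ℕ) := by
  classical
  obtain ⟨z, ⟨hz, hxz⟩, hmin⟩ := Int.exists_least_of_bdd (P := fun z => z ∈ C ∧ x ≤ z)
    ⟨x, fun z hz => hz.2⟩
    ⟨w + h * (|x| + |w|), hC.periodic w hw _, by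
      have h1 := le_abs_self x
      have h2 := neg_abs_le w
      nlinarith [abs_nonneg x, abs_nonneg w]⟩
  refine ⟨z, (z - x).toNat, ⟨hz, fun t ht hti hm => ?_⟩, by omega⟩
  have := hmin _ ⟨hm, by omega⟩
  omega

lemma low_block (hC : IsReturnCycle h q A C) (hAC : A ∈ C) (hAh : A < h) {i : ℕ}
    (H : Label C 1 (i + 2)) : h * (-1) + A < 1 - (i + 2 : ℕ) := by
  refine H.lt ?_ (by linarith)
  rw [add_comm]; exact hC.periodic A hAC (-1)

section Zone

variable (hh : 0 < h) (hC : IsReturnCycle h q A C) (h1C : (1 : ℤ) ∈ C) (hAC : A ∈ C)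
  (hA1 : 1 ≤ A) (hAh : A < h)

include hh hC h1C hAC hA1 hAh

lemma returnStep_sub {z : ℤ} {i : ℕ} (H : Label C z i) (hz : ¬ h ∣ z - 1) :
    ¬ h ∣ z - i ∧ returnStep h q A (z - i) = returnStep h q A z - i := by
  obtain ⟨k, hk, hk'⟩ := exists_block hh (hC.not_dvd H.1)
  have h1 : h * k + 1 < z := by
    rcases (show h * k + 1 < z ∨ z = h * k + 1 by omega) with h2 | h2
    · exact h2
    · exact absurd ⟨k, by linarith⟩ hz
  have h2 : h * k + 1 < z - i := H.lt (by rw [add_comm]; exact hC.periodic 1 h1C k) h1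
  refine ⟨not_dvd_of_block hh (k := k) (by linarith) (by omega), ?_⟩
  rcases le_or_gt z (h * k + A) with h3 | h3
  · rw [returnStep_low hAh hk.le h3, returnStep_low (k := k) hAh (by linarith) (by omega)]; ring
  · have h4 : h * k + A < z - i := H.lt (by rw [add_comm]; exact hC.periodic A hAC k) h3
    rw [returnStep_high (by linarith) h3 hk', returnStep_high (k := k) (by linarith) h4 (by omega)]
    ring

lemma label_step {z : ℤ} {i : ℕ} (H : Label C z i) (hz : ¬ h ∣ z - 1) :
    Label C (returnStep h q A z) i := by
  refine ⟨hC.maps z H.1, fun t ht hti => ?_⟩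
  obtain ⟨h1, h2⟩ := returnStep_sub hh hC h1C hAC hA1 hAh (H.mono hti) hz
  rw [← h2]
  exact hC.returnStep_notMem hh h1 (H.2 t ht hti)

lemma label_one {i : ℕ} (H : Label C 1 (i + 1)) : Label C (returnStep h q A 1) i := by
  refine ⟨hC.maps 1 h1C, fun t ht hti => ?_⟩
  obtain ⟨s, rfl⟩ : ∃ s, t = s + 1 := ⟨t - 1, by omega⟩
  have H' : Label C 1 (s + 2) := H.mono (by omega)
  have h1 := hC.low_block hAC hAh H'
  have h2 := H'.2 (s + 2) (by omega) le_rfl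
  have h3 := hC.returnStep_notMem hh
    (not_dvd_of_block hh (k := -1) (by linarith) (by push_cast; linarith)) h2
  rw [returnStep_high (k := -1) (by linarith) h1 (by push_cast; linarith)] at h3
  rw [returnStep_low (k := 0) hAh (by linarith) (by linarith)]
  rwa [show (1 : ℤ) - (s + 2 : ℕ) + q + 1 = 1 + q - (s + 1 : ℕ) by push_cast; ring] at h3

/-- Moving the threshold of a return cycle with large gaps. -/
theorem absorbing (gap : ∀ x ∈ C, ∀ y ∈ C, x < y → x + G ≤ y) {j : ℕ} (hj : Even j)
    (hjG : j = 0 ∨ ((j : ℤ) + 2 ≤ G ∧ 1 < A)) : Absorbing h q (A - 1 - j) := by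
  set B := A - 1 - j with hB
  have hAG : 1 < A → 1 + G ≤ A := gap 1 h1C A hAC
  have hB0 : 0 ≤ B := by rcases hjG with rfl | ⟨h1, h2⟩ <;> [(push_cast at hB; omega); omega]
  have hB1 : 1 < A → 1 ≤ B := by
    intro h0
    rcases hjG with rfl | ⟨h1, h2⟩ <;> [(push_cast at hB; omega); omega]
  have hBh : B < h := by omega
  let D : ℤ → ℕ → Prop := fun z i => Label C z i → Reaches h q B (z - i)
  have Dcongr : ∀ i x y, h ∣ y - x → D x i → D y i := by
    intro i x y e H hl
    have e' : h ∣ x - y := by have := (dvd_neg (a := h)).2 e; rwa [neg_sub] at this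
    refine (H (hC.label_congr e' hl)).congr ?_
    rwa [sub_sub_sub_cancel_right]
  have generic : ∀ z i, ¬ h ∣ z - 1 → (h ∣ z - A → j < i) → D (returnStep h q A z) i → D z i := by
    intro z i hz hzA H hl
    refine reaches_of_step ?_ (H (label_step hh hC h1C hAC hA1 hAh hl hz))
    obtain ⟨k, hk, hk'⟩ := exists_block hh (hC.not_dvd hl.1)
    have hkA : h * k + A ∈ C := by rw [add_comm]; exact hC.periodic A hAC k
    have hk1 : h * k + 1 ∈ C := by rw [add_comm]; exact hC.periodic 1 h1C k
    have h1 : h * k + 1 < z := by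
      rcases (show h * k + 1 < z ∨ z = h * k + 1 by omega) with h2 | h2
      · exact h2
      · exact absurd ⟨k, by linarith⟩ hz
    have h2 := hl.lt hk1 h1
    rcases lt_trichotomy z (h * k + A) with h3 | h3 | h3
    · have h4 := gap _ hl.1 _ hkA h3
      rw [returnStep_low (k := k) hAh hk.le h3.le,
        returnStep_low (k := k) hBh (by linarith) (by omega)]
      ring
    · have h4 := hzA ⟨k, by linarith⟩
      rw [returnStep_low (k := k) hAh hk.le h3.le,
        returnStep_low (k := k) hBh (by linarith) (by omega)]
      ring
    · have h4 := hl.lt hkA h3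
      rw [returnStep_high (k := k) (by linarith) h3 hk',
        returnStep_high (k := k) hB0 (by omega) (by omega)]
      ring
  have one_one : D 1 1 := fun _ => reaches_of_dvd (by simp)
  have one_ge : ∀ i, D (returnStep h q A 1) (i + 1) → D 1 (i + 2) := by
    intro i H hl
    refine reaches_of_step ?_ (H (label_one hh hC h1C hAC hA1 hAh hl))
    have h1 := hC.low_block hAC hAh hl
    rw [returnStep_high (k := -1) hB0 (by omega) (by push_cast; linarith),
      returnStep_low (k := 0) hAh (by linarith) (by linarith)]
    push_cast; ring
  have one_zero : 1 < A → D (returnStep h q A 1) 0 → D 1 0 := by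
    intro h1 H hl
    refine reaches_of_step ?_ (H ⟨hC.maps 1 h1C, fun t ht ht' => by omega⟩)
    have := hB1 h1
    rw [returnStep_low (k := 0) hBh (by push_cast; linarith) (by push_cast; linarith),
      returnStep_low (k := 0) hAh (by linarith) (by linarith)]
    push_cast; ring
  have hA_mid : 1 < A → ∀ i, i + 1 ≤ j → D (returnStep h q A A) i → D A (i + 1) := by
    intro h1 i hi H hl
    have hA1' : ¬ h ∣ A - 1 := not_dvd_of_block hh (k := 0) (by linarith) (by linarith)
    refine reaches_of_step ?_ (H ((label_step hh hC h1C hAC hA1 hAh hl hA1').mono (by omega)))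
    have h2 := hl.lt h1C h1
    rw [returnStep_high (k := 0) hB0 (by push_cast at *; omega) (by push_cast at *; omega),
      returnStep_low (k := 0) hAh (by linarith) (by linarith)]
    push_cast; ring
  have hA_zero : (∀ z i, j + 1 ≤ i → D z i) → D A 0 := by
    intro H hl
    have e1 : returnStep h q A A = A + q :=
      returnStep_low (k := 0) hAh (by linarith) (by linarith)
    have hn : A + q + 1 ∉ C := by
      intro hm
      obtain ⟨y, hy, e⟩ := hC.exists_preimage hm
      have hyA : A < y := by
        by_contra! hle
        rcases hle.lt_or_eq with hlt | rfl
        · have := returnStep_lt (q := q) (A := A) hh (hC.not_dvd hy) (hC.not_dvd hAC) hlt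
          omega
        · omega
      have h2 : y = A + 1 := by
        have : y + q ≤ returnStep h q A y := by unfold returnStep; split_ifs <;> linarith
        omega
      have h3 : y < h := by
        rcases (show y < h ∨ y = h by omega) with h3 | h3
        · exact h3
        · exact absurd ⟨1, by linarith⟩ (hC.not_dvd hy)
      rw [returnStep_high (k := 0) (by linarith) (by linarith) (by linarith)] at e
      omega
    obtain ⟨z, i, hzi, e⟩ := exists_label hh hC hAC (A + q + 1)
    have hAq : A + q ∈ C := e1 ▸ hC.maps A hAC
    have hi0 : i ≠ 0 := by
      rintro rfl
      exact hn (by rw [e]; simpa using hzi.1)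
    have hgap := gap _ hAq z hzi.1 (by omega)
    have hji : j + 1 ≤ i := by rcases hjG with rfl | ⟨h1, h2⟩ <;> omega
    refine reaches_of_step ?_ (H z i hji hzi)
    rw [returnStep_high (k := 0) hB0 (by push_cast; omega) (by push_cast; omega), ← e]
    push_cast; ring
  have to_one : ∀ i, D 1 i → D (returnStep h q A A) i := fun i H =>
    hC.propagate hAC h1C (fun z => D z i) (Dcongr i)
      (fun z _ hz hz1 => generic z i hz1 fun hd => absurd hd hz) H
  have to_A : ∀ i, D A i → D (returnStep h q A 1) i := fun i H =>
    hC.propagate h1C hAC (fun z => D z i) (Dcongr i)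
      (fun z _ hz hzA => generic z i hz fun hd => absurd hd hzA) H
  have hA_big : ∀ i, j + 1 ≤ i → D 1 i → D A i := by
    intro i hi H
    by_cases h1 : A = 1
    · rwa [h1]
    · exact generic A i (not_dvd_of_block hh (k := 0) (by omega) (by omega)) (fun _ => hi)
        (to_one i H)
  have odd_small : ∀ e, 2 * e ≤ j → D 1 (2 * e + 1) := by
    intro e
    induction e with
    | zero => intro _; exact one_one
    | succ e ih =>
      intro he
      have h1 : 1 < A := by rcases hjG with rfl | ⟨_, h2⟩ <;> [omega; exact h2]
      exact one_ge _ (to_A _ (hA_mid h1 _ (by omega) (to_one _ (ih (by omega)))))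
  have one_big : ∀ i, D 1 (j + 1 + i) := by
    intro i
    induction i with
    | zero =>
      obtain ⟨e, he⟩ := hj
      have := odd_small e (by omega)
      rwa [show j + 1 + 0 = 2 * e + 1 by omega]
    | succ i ih =>
      have := one_ge (j + i) (to_A _ (hA_big _ (by omega) (by rwa [show j + i + 1 = j + 1 + i by ring])))
      rwa [show j + 1 + (i + 1) = j + i + 2 by ring]
  have flow : ∀ i, D 1 i → D A i → ∀ z ∈ C, D z i := by
    intro i h1 hA z hz
    obtain ⟨w, hw, rfl⟩ := hC.exists_preimage hz
    exact hC.propagate hw h1C (fun z => D z i) (Dcongr i) (fun z _ _ hz1 H => by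
      by_cases hzA : h ∣ z - A
      · exact Dcongr i A z hzA hA
      · exact generic z i hz1 (fun hd => absurd hd hzA) H) h1
  have big : ∀ z i, j + 1 ≤ i → D z i := by
    intro z i hi hl
    have h1 : D 1 i := by
      have := one_big (i - (j + 1))
      rwa [show j + 1 + (i - (j + 1)) = i by omega] at this
    exact flow i h1 (hA_big i hi h1) z hl.1 hl
  have A0 := hA_zero big
  have one_all : ∀ i, D 1 i := by
    intro i
    induction i using Nat.strong_induction_on with
    | _ i ih =>
      rcases (show i = 0 ∨ i = 1 ∨ 2 ≤ i by omega) with rfl | rfl | hi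
      · by_cases h1 : A = 1
        · rwa [h1] at A0
        · exact one_zero (by omega) (to_A 0 A0)
      · exact one_one
      · by_cases hij : j + 1 ≤ i
        · exact big 1 i hij
        · obtain ⟨s, rfl⟩ : ∃ s, i = s + 2 := ⟨i - 2, by omega⟩
          have h1 : 1 < A := by rcases hjG with rfl | ⟨_, h2⟩ <;> [omega; exact h2]
          exact one_ge s (to_A _ (hA_mid h1 s (by omega) (to_one s (ih s (by omega)))))
  have A_all : ∀ i, D A i := by
    intro i
    rcases (show i = 0 ∨ j + 1 ≤ i ∨ (1 ≤ i ∧ i ≤ j) by omega) with rfl | hi | ⟨hi, hi'⟩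
    · exact A0
    · exact big A i hi
    · obtain ⟨s, rfl⟩ : ∃ s, i = s + 1 := ⟨i - 1, by omega⟩
      have h1 : 1 < A := by rcases hjG with rfl | ⟨_, h2⟩ <;> [omega; exact h2]
      exact hA_mid h1 s hi' (to_one s (one_all s))
  intro x
  obtain ⟨z, i, hzi, rfl⟩ := exists_label hh hC h1C x
  exact flow i (one_all i) (A_all i) z hzi.1 hzi

end Zone

end IsReturnCycle

section Pure

variable {h q : ℤ}

lemma iterate_returnStep_sub {A x : ℤ} (d : ℤ) (hd : d ∣ q) (H : ∀ z, d ∣ z - x → returnStep h q A z = z + q)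
    (n : ℕ) : (returnStep h q A)^[n] x = x + n * q := by
  induction n with
  | zero => simp
  | succ n ih =>
    rw [Function.iterate_succ_apply', ih, H]
    · push_cast; ring
    · rw [add_sub_cancel_left]; exact Dvd.dvd.mul_left hd _

lemma isReturnCycle_gcd (hh : 1 < h) (hd : (Int.gcd q h : ℤ) ≠ 1) :
    IsReturnCycle h q (h - Int.gcd q h + 1) {x | (Int.gcd q h : ℤ) ∣ x - 1} := by
  have hd0 : (0 : ℤ) ≤ Int.gcd q h := by positivity
  have hdq : (Int.gcd q h : ℤ) ∣ q := Int.gcd_dvd_left ..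
  have hdh : (Int.gcd q h : ℤ) ∣ h := Int.gcd_dvd_right ..
  have conn : ∀ x y, (Int.gcd q h : ℤ) ∣ y - x → ∃ (n : ℕ) (k : ℤ), y = x + n * q + h * k :=
    fun x y => exists_mul_add (by linarith)
  generalize (Int.gcd q h : ℤ) = d at *
  replace hd0 : 0 < d := by
    rcases hd0.lt_or_eq with h1 | h1
    · exact h1
    · rw [← h1] at hdh; have := zero_dvd_iff.1 hdh; omega
  have hdle : d ≤ h := Int.le_of_dvd (by linarith) hdh
  have step : ∀ x, d ∣ x - 1 → returnStep h q (h - d + 1) x = x + q := by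
    intro x hx
    have hnd : ¬ h ∣ x := by
      intro hx'
      have : d ∣ 1 := by simpa using dvd_sub (hdh.trans hx') hx
      exact hd (Int.eq_one_of_dvd_one hd0.le this)
    obtain ⟨k, hk, hk'⟩ := exists_block (by linarith) hnd
    rcases le_or_gt x (h * k + (h - d + 1)) with h1 | h1
    · exact returnStep_low (by omega) hk.le h1
    · exfalso
      have h2 : d ∣ x - (h * k + h - d + 1) := by
        have e : x - (h * k + h - d + 1) = (x - 1) - h * k - h + d := by ring
        rw [e]
        exact dvd_add (dvd_sub (dvd_sub hx (hdh.mul_right k)) hdh) dvd_rfl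
      have := Int.le_of_dvd (by linarith) h2
      linarith
  refine ⟨fun x hx k => ?_, ?_, fun x hx => ?_, fun x hx y hy => ?_⟩
  · have e : x + h * k - 1 = (x - 1) + h * k := by ring
    rw [Set.mem_ofPred_eq, e]
    exact dvd_add hx (hdh.mul_right k)
  · intro h0
    have : d ∣ 1 := by simpa using h0
    exact hd (Int.eq_one_of_dvd_one hd0.le this)
  · rw [step x hx, Set.mem_ofPred_eq, show x + q - 1 = (x - 1) + q by ring]
    exact dvd_add hx hdq
  · have hxy : d ∣ y - x := by
      have := dvd_sub hy hx
      rwa [sub_sub_sub_cancel_right] at this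
    obtain ⟨n, k, e⟩ := conn x y hxy
    refine ⟨n, -k, ?_⟩
    rw [iterate_returnStep_sub d hdq fun z hz => step z ?_]
    · linarith
    · have := dvd_add hz hx
      rwa [sub_add_sub_cancel] at this

/-- The quasi-paths supplied by a nontrivial common divisor of `q` and `h`. -/
theorem absorbing_of_gcd (hh : 1 < h) {j : ℕ} (hj : Even j)
    (hjd : j = 0 ∨ ((j : ℤ) + 2 ≤ Int.gcd q h ∧ (Int.gcd q h : ℤ) < h)) :
    Absorbing h q (h - Int.gcd q h - j) := by
  by_cases hd : (Int.gcd q h : ℤ) = 1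
  · have hj0 : j = 0 := by omega
    rw [hd, hj0]
    intro x
    obtain ⟨n, k, e⟩ := exists_mul_add (x := x) (y := 0) (q := q) (h := h) (by linarith)
      (by rw [hd]; exact one_dvd _)
    have key : ∀ x, returnStep h q (h - 1 - (0 : ℕ)) x = x + q := by
      intro x
      have := Int.emod_lt_of_pos x (show 0 < h by linarith)
      rw [returnStep, if_pos (by push_cast; omega)]
    refine ⟨n, -k, ?_⟩
    rw [iterate_returnStep_sub 1 (one_dvd _) fun z _ => key z]
    linarith
  · have hle : (Int.gcd q h : ℤ) ≤ h := Int.le_of_dvd (by linarith) (Int.gcd_dvd_right ..)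
    have h0 : (Int.gcd q h : ℤ) ≠ 0 := by
      intro h0
      have := Int.gcd_eq_zero_iff.1 (by exact_mod_cast h0)
      omega
    have hp : (0 : ℤ) ≤ Int.gcd q h := by positivity
    have hdh : (Int.gcd q h : ℤ) ∣ h := Int.gcd_dvd_right ..
    have := (isReturnCycle_gcd hh hd).absorbing (G := Int.gcd q h) (by linarith) (by simp)
      (by simpa using hdh) (by linarith) (by omega)
      (fun x hx y hy hxy => by
        have h1 := dvd_sub hy hx
        rw [sub_sub_sub_cancel_right] at h1
        have := Int.le_of_dvd (by linarith) h1
        linarith) hj (by omega)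
    rwa [add_sub_cancel_right] at this

end Pure

/-- Quasi-paths whose rotation number has a small inverse modulo `h`. -/
theorem absorbing_of_mul_eq_one {h r τ : ℤ} (hh : 1 < h) (hτ : 1 ≤ τ) (hr : h ∣ τ * r - 1) {c : ℕ}
    (hc : Even c) (hcτ : c * τ < h) : Absorbing h r (h - 1 - c) := by
  obtain ⟨w, hw⟩ := hr
  have hch : (c : ℤ) < h := by nlinarith
  have walk : ∀ (i : ℕ) (s : ℕ), i ≤ c → 1 ≤ h - i * τ - s → (i < c → h - (i + 1) * τ < h - i * τ - s) →
      Reaches h r (h - 1 - c) (r * (h - i * τ)) →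
      Reaches h r (h - 1 - c) (r * (h - i * τ - s)) := by
    intro i s hi
    induction s with
    | zero => intro _ _ H; simpa using H
    | succ s ih =>
      intro h1 h2 H
      push_cast at h1 h2 ⊢
      have hs := ih (by linarith) (fun hic => by linarith [h2 hic]) H
      set n : ℤ := h - i * τ - (s + 1) with hn
      have hn' : h - i * τ - s = n + 1 := by rw [hn]; ring
      rw [hn'] at hs
      refine reaches_of_step ?_ hs
      rw [returnStep, if_pos]
      · ring
      by_contra! hlt
      have hm := Int.emod_add_mul_ediv (r * n) h
      have hmlt := Int.emod_lt_of_pos (r * n) (show 0 < h by linarith)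
      set x := (r * n) % h with hx
      have hnx : n - (h - (h - x) * τ) = h * (τ * ((r * n) / h) - 1 + τ - w * n) := by
        linear_combination (-n) * hw + (-τ) * hm
      have hle : (h - x) * τ ≤ c * τ := by nlinarith
      have hpos : τ ≤ (h - x) * τ := by nlinarith
      have hiτ : 0 ≤ (i : ℤ) * τ := by positivity
      have hnh : n < h := by rw [hn]; linarith
      have hzero : τ * ((r * n) / h) - 1 + τ - w * n = 0 := by
        set z := τ * ((r * n) / h) - 1 + τ - w * n
        have a1 : z < 1 := by
          by_contra! hz; nlinarith
        have a2 : -1 < z := by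
          by_contra! hz; nlinarith
        omega
      rw [hzero, mul_zero] at hnx
      rcases le_or_gt (h - x) i with h3 | h3
      · have : (h - x) * τ ≤ i * τ := by nlinarith
        linarith
      · have h4 := h2 (by omega)
        have : ((i : ℤ) + 1) * τ ≤ (h - x) * τ := by nlinarith
        linarith
  have jump : ∀ i : ℕ, 1 ≤ i → i ≤ c → Reaches h r (h - 1 - c) (r * (h - (i - 1) * τ + 1)) →
      Reaches h r (h - 1 - c) (r * (h - i * τ)) := by
    intro i h1 h2 H
    have e : r * (h - i * τ) = h * (r - i * w - 1) + (h - i) := by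
      linear_combination (-(i : ℤ)) * hw
    have h1' : (1 : ℤ) ≤ i := by exact_mod_cast h1
    have h2' : (i : ℤ) ≤ c := by exact_mod_cast h2
    refine reaches_of_step rfl (H.congr ?_)
    rw [returnStep_high (k := r - i * w - 1) (by linarith) (by linarith) (by linarith)]
    exact ⟨-w, by linear_combination -hw⟩
  have even : ∀ e : ℕ, 2 * e ≤ c → Reaches h r (h - 1 - c) (r * (h - (2 * e : ℕ) * τ)) := by
    intro e
    induction e with
    | zero => intro _; exact reaches_of_dvd (by simp)
    | succ e ih =>
      intro he
      refine jump _ (by omega) he ?_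
      have hle : ((2 * e + 1 : ℕ) : ℤ) * τ ≤ c * τ := by
        have : ((2 * e + 1 : ℕ) : ℤ) ≤ c := by omega
        nlinarith
      push_cast at hle
      have := walk (2 * e) (τ - 1).toNat (by omega)
        (by rw [Int.toNat_of_nonneg (by linarith)]; push_cast; linarith)
        (fun _ => by rw [Int.toNat_of_nonneg (by linarith)]; push_cast; linarith) (ih (by omega))
      rw [Int.toNat_of_nonneg (by linarith)] at this
      convert this using 2
      push_cast; ring
  have one : 1 ≤ c → Reaches h r (h - 1 - c) (r * (h - (1 : ℕ) * τ)) := by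
    intro h1
    refine jump 1 le_rfl h1 ?_
    obtain ⟨e, he⟩ := hc
    have hce := even e (by omega)
    rw [show 2 * e = c by omega] at hce
    have := walk c (h - c * τ - 1).toNat le_rfl (by omega) (fun h => absurd h (lt_irrefl _)) hce
    rw [Int.toNat_of_nonneg (by linarith)] at this
    refine this.congr ⟨r, ?_⟩
    push_cast; ring
  have odd : ∀ e : ℕ, 2 * e + 1 ≤ c →
      Reaches h r (h - 1 - c) (r * (h - (2 * e + 1 : ℕ) * τ)) := by
    intro e
    induction e with
    | zero => intro h1; exact one h1
    | succ e ih =>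
      intro he
      refine jump _ (by omega) he ?_
      have hle : ((2 * e + 2 : ℕ) : ℤ) * τ ≤ c * τ := by
        have : ((2 * e + 2 : ℕ) : ℤ) ≤ c := by omega
        nlinarith
      push_cast at hle
      have := walk (2 * e + 1) (τ - 1).toNat (by omega)
        (by rw [Int.toNat_of_nonneg (by linarith)]; push_cast; linarith)
        (fun _ => by rw [Int.toNat_of_nonneg (by linarith)]; push_cast; linarith) (ih (by omega))
      rw [Int.toNat_of_nonneg (by linarith)] at this
      convert this using 2
      push_cast; ring
  intro x
  have hm := Int.emod_add_mul_ediv (τ * x) h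
  have hm0 := Int.emod_nonneg (τ * x) (show h ≠ 0 by linarith)
  have hmlt := Int.emod_lt_of_pos (τ * x) (show 0 < h by linarith)
  set n := (τ * x) % h
  have hxn : x - r * n = h * (r * ((τ * x) / h) - w * x) := by
    linear_combination (-x) * hw + (-r) * hm
  rcases hm0.eq_or_lt with h0 | h0
  · refine reaches_of_dvd ⟨r * ((τ * x) / h) - w * x, ?_⟩
    rw [← h0] at hxn; linarith
  suffices Reaches h r (h - 1 - c) (r * n) from this.congr ⟨_, hxn⟩
  have d0 : 0 ≤ (h - n) / τ := Int.ediv_nonneg (by linarith) (by linarith)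
  have d1 := Int.mul_ediv_self_le (x := h - n) (k := τ) (by linarith)
  have d2 := Int.lt_mul_ediv_self_add (x := h - n) (k := τ) (by linarith)
  obtain ⟨i, hic, hi1, hi2⟩ : ∃ i : ℕ, i ≤ c ∧ i * τ ≤ h - n ∧ (i < c → h - n < (i + 1) * τ) := by
    rcases le_or_gt (c : ℤ) ((h - n) / τ) with h1 | h1
    · exact ⟨c, le_rfl, by nlinarith, fun h => absurd h (lt_irrefl _)⟩
    · refine ⟨((h - n) / τ).toNat, by omega, ?_, fun _ => ?_⟩
      · rw [Int.toNat_of_nonneg d0]; linarith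
      · rw [Int.toNat_of_nonneg d0]; linarith
  have hQ : Reaches h r (h - 1 - c) (r * (h - i * τ)) := by
    rcases Nat.even_or_odd' i with ⟨e, rfl | rfl⟩
    · exact even e hic
    · exact odd e hic
  have := walk i (h - i * τ - n).toNat hic (by omega) (fun hlt => by have := hi2 hlt; omega) hQ
  rwa [Int.toNat_of_nonneg (by linarith), sub_sub_cancel] at this

section Existence

variable {h q A : ℤ}

lemma iterate_returnStep_congr (n : ℕ) {x y : ℤ} (e : h ∣ x - y) :
    h ∣ (returnStep h q A)^[n] x - (returnStep h q A)^[n] y := by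
  obtain ⟨k, hk⟩ := e
  obtain rfl : x = y + h * k := by linarith
  rw [iterate_returnStep_add, add_sub_cancel_left]
  exact dvd_mul_right _ _

lemma exists_isReturnCycle (hh : 0 < h) (H : ¬ Absorbing h q A) :
    ∃ C, IsReturnCycle h q A C ∧ C.Nonempty := by
  unfold Absorbing Reaches at H
  push Not at H
  obtain ⟨x, hx⟩ := H
  set f := returnStep h q A with hf
  obtain ⟨a, b, hab, e⟩ : ∃ a b : ℕ, a < b ∧ h ∣ f^[b] x - f^[a] x := by
    have hfin : ∀ n : ℕ, (fun n : ℕ => (f^[n] x) % h) n ∈ Set.Ico 0 h := fun n =>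
      ⟨Int.emod_nonneg _ hh.ne', Int.emod_lt_of_pos _ hh⟩
    obtain ⟨a, b, hab, e⟩ := Set.Finite.exists_lt_map_eq_of_forall_mem hfin (Set.finite_Ico 0 h)
    exact ⟨a, b, hab, (Int.emod_eq_emod_iff_emod_sub_eq_zero.1 e.symm) |> Int.dvd_of_emod_eq_zero⟩
  set y := f^[a] x with hy
  obtain ⟨p, rfl⟩ : ∃ p, b = p + 1 + a := ⟨b - a - 1, by omega⟩
  rw [Function.iterate_add_apply, ← hy] at e
  have per : ∀ i : ℕ, h ∣ f^[(p + 1) * i] y - y := by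
    intro i
    induction i with
    | zero => simp
    | succ i ih =>
      have h1 := iterate_returnStep_congr (q := q) (A := A) (p + 1) ih
      rw [← hf, ← Function.iterate_add_apply] at h1
      have h2 := dvd_add h1 e
      rwa [sub_add_sub_cancel, show p + 1 + (p + 1) * i = (p + 1) * (i + 1) by ring] at h2
  refine ⟨{z | ∃ i : ℕ, h ∣ f^[i] y - z}, ⟨?_, ?_, ?_, ?_⟩, y, 0, by simp⟩
  · rintro z ⟨i, hi⟩ k
    exact ⟨i, by rw [← sub_sub]; exact dvd_sub hi (dvd_mul_right _ _)⟩
  · rintro ⟨i, hi⟩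
    rw [sub_zero, hy, ← Function.iterate_add_apply] at hi
    exact hx _ hi
  · rintro z ⟨i, hi⟩
    refine ⟨i + 1, ?_⟩
    rw [Function.iterate_succ_apply']
    exact iterate_returnStep_congr 1 hi
  · rintro z ⟨i, hi⟩ w ⟨j, hj⟩
    refine ⟨p * i + j, ?_⟩
    have h1 := iterate_returnStep_congr (q := q) (A := A) (p * i + j) hi
    have h2 := iterate_returnStep_congr (q := q) (A := A) j (per i)
    rw [← hf, ← Function.iterate_add_apply] at h1 h2
    rw [show p * i + j + i = j + (p + 1) * i by ring] at h1
    have := dvd_add (dvd_sub h2 h1) hj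
    rwa [sub_sub_sub_cancel_left, sub_add_sub_cancel] at this

namespace IsReturnCycle

variable {C : Set ℤ}

lemma exists_high (hh : 0 < h) (hC : IsReturnCycle h q A C) {x : ℤ} (hx : x ∈ C)
    (hd : (Int.gcd q h : ℤ) ≤ h - A) (hA : A < h) : ∃ u ∈ C, A < u ∧ u < h := by
  by_contra! H
  have low : ∀ z ∈ C, z + q ∈ C := by
    intro z hz
    obtain ⟨k, hk, hk'⟩ := exists_block hh (hC.not_dvd hz)
    have h1 := H (z + h * -k) (hC.periodic z hz _)
    have := hC.maps z hz
    rwa [returnStep_low (k := k) hA hk.le (by by_contra! h2; linarith [h1 (by linarith)])] at this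
  have lows : ∀ (n : ℕ), x + n * q ∈ C := by
    intro n
    induction n with
    | zero => simpa using hx
    | succ n ih => have := low _ ih; push_cast; rwa [add_one_mul, ← add_assoc]
  have hd0 : (0 : ℤ) < Int.gcd q h := by
    have : Int.gcd q h ≠ 0 := fun h0 => by have := (Int.gcd_eq_zero_iff.1 h0).2; omega
    omega
  have h1 := Int.emod_nonneg (x - (A + 1)) hd0.ne'
  have h2 := Int.emod_lt_of_pos (x - (A + 1)) hd0
  obtain ⟨n, k, e⟩ := exists_mul_add (q := q) hh (x := x)
    (y := A + 1 + (x - (A + 1)) % Int.gcd q h) (by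
      have := Int.emod_add_mul_ediv (x - (A + 1)) (Int.gcd q h)
      exact ⟨-((x - (A + 1)) / Int.gcd q h), by linarith⟩)
  have hy := hC.periodic _ (lows n) k
  rw [← e] at hy
  have := H _ hy (by omega)
  have h4 : A + 1 + (x - (A + 1)) % Int.gcd q h = h := by omega
  exact hC.not_dvd hy (by rw [h4])

lemma exists_low (hh : 0 < h) (hC : IsReturnCycle h q A C) {x : ℤ} (hx : x ∈ C)
    (hd : (Int.gcd (q + 1) h : ℤ) ≤ A + 1) (hA0 : 0 ≤ A) : ∃ u ∈ C, 0 < u ∧ u ≤ A := by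
  by_contra! H
  have high : ∀ z ∈ C, z + (q + 1) ∈ C := by
    intro z hz
    obtain ⟨k, hk, hk'⟩ := exists_block hh (hC.not_dvd hz)
    have h1 := H (z + h * -k) (hC.periodic z hz _) (by linarith)
    have := hC.maps z hz
    rwa [returnStep_high (k := k) hA0 (by linarith) hk', add_assoc] at this
  have highs : ∀ (n : ℕ), x + n * (q + 1) ∈ C := by
    intro n
    induction n with
    | zero => simpa using hx
    | succ n ih => have := high _ ih; push_cast; rwa [add_one_mul, ← add_assoc]
  have hd0 : (0 : ℤ) < Int.gcd (q + 1) h := by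
    have : Int.gcd (q + 1) h ≠ 0 := fun h0 => by have := (Int.gcd_eq_zero_iff.1 h0).2; omega
    omega
  have h1 := Int.emod_nonneg x hd0.ne'
  have h2 := Int.emod_lt_of_pos x hd0
  obtain ⟨n, k, e⟩ := exists_mul_add (q := q + 1) hh (x := x) (y := x % Int.gcd (q + 1) h) (by
      have := Int.emod_add_mul_ediv x (Int.gcd (q + 1) h)
      exact ⟨-(x / Int.gcd (q + 1) h), by linarith⟩)
  have hy := hC.periodic _ (highs n) k
  rw [← e] at hy
  rcases h1.eq_or_lt with h0 | h0
  · rw [← h0] at hy; exact hC.zero_notMem hy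
  · have := H _ hy h0; omega

/-- Consecutive elements of `C`. -/
def Adj (C : Set ℤ) (x z : ℤ) : Prop := x ∈ C ∧ z ∈ C ∧ x < z ∧ ∀ w ∈ C, w ≤ x ∨ z ≤ w

lemma Adj.unique {x y z : ℤ} (H : Adj C x z) (H' : Adj C y z) : x = y := by
  have h1 := H.2.2.2 y H'.1
  have h2 := H'.2.2.2 x H.1
  have := H.2.2.1
  have := H'.2.2.1
  omega

lemma Adj.step (hh : 0 < h) (hC : IsReturnCycle h q A C) {x z : ℤ} (H : Adj C x z) :
    Adj C (returnStep h q A x) (returnStep h q A z) := by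
  obtain ⟨hx, hz, hxz, hb⟩ := H
  have mono : ∀ u ∈ C, ∀ v ∈ C, u ≤ v → returnStep h q A u ≤ returnStep h q A v := by
    intro u hu v hv huv
    rcases huv.lt_or_eq with h1 | rfl
    · exact (returnStep_lt hh (hC.not_dvd hu) (hC.not_dvd hv) h1).le
    · exact le_rfl
  refine ⟨hC.maps x hx, hC.maps z hz, returnStep_lt hh (hC.not_dvd hx) (hC.not_dvd hz) hxz,
    fun w hw => ?_⟩
  obtain ⟨v, hv, rfl⟩ := hC.exists_preimage hw
  exact (hb v hv).imp (mono v hv x hx) (mono z hz v hv)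

lemma Adj.add (hC : IsReturnCycle h q A C) {x z : ℤ} (H : Adj C x z) (k : ℤ) :
    Adj C (x + h * k) (z + h * k) := by
  obtain ⟨hx, hz, hxz, hb⟩ := H
  refine ⟨hC.periodic x hx k, hC.periodic z hz k, by linarith, fun w hw => ?_⟩
  have := hb _ (hC.periodic w hw (-k))
  rcases this with h1 | h1
  · left; linarith
  · right; linarith

lemma exists_adj (hh : 0 < h) (hC : IsReturnCycle h q A C) {z : ℤ} (hz : z ∈ C) :
    ∃ x, Adj C x z := by
  classical
  obtain ⟨x, ⟨hx, hxz⟩, hmax⟩ := Int.exists_greatest_of_bdd (P := fun x => x ∈ C ∧ x < z)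
    ⟨z, fun w hw => hw.2.le⟩ ⟨z + h * (-1), hC.periodic z hz _, by linarith⟩
  refine ⟨x, hx, hz, hxz, fun w hw => ?_⟩
  by_contra! h1
  have := hmax w ⟨hw, h1.2⟩
  omega

/-- All gaps of a return cycle lie in `{g - 1, g}`, where `g` is the gap around the multiples
of `h`. -/
lemma gaps (hh : 0 < h) (hC : IsReturnCycle h q A C) (hA0 : 0 ≤ A) (hAh : A < h) {β ω u : ℤ}
    (hβω : Adj C ω β) (hβ0 : 0 < β) (hβA : β ≤ A) (hmin : ∀ x ∈ C, 0 < x → β ≤ x)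
    (hu : u ∈ C) (huA : A < u) (huh : u < h) :
    ∀ x z, Adj C x z → β - ω - 1 ≤ z - x ∧ z - x ≤ β - ω := by
  have hβ := hβω.2.1
  have expand : ∀ x z, Adj C x z → ¬ h ∣ z - β →
      z - x ≤ returnStep h q A z - returnStep h q A x := by
    intro x z H hz
    obtain ⟨k, hk, hk'⟩ := exists_block hh (hC.not_dvd H.2.1)
    have h1 := hmin _ (hC.periodic z H.2.1 (-k)) (by linarith)
    have h2 : h * k + β < z := by
      rcases (show h * k + β < z ∨ z = h * k + β by
        rcases h1.lt_or_eq with h2 | h2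
        · left; linarith
        · right; linarith) with h2 | h2
      · exact h2
      · exact absurd ⟨k, by linarith⟩ hz
    have h3 : h * k + β ≤ x := by
      have := H.2.2.2 (h * k + β) (by rw [add_comm]; exact hC.periodic β hβ k)
      rcases this with h3 | h3
      · exact h3
      · linarith
    have hxz := H.2.2.1
    rcases le_or_gt z (h * k + A) with h4 | h4
    · rw [returnStep_low (k := k) hAh hk.le h4,
        returnStep_low (k := k) hAh (by linarith) (by linarith)]
      linarith
    · rw [returnStep_high (k := k) hA0 h4 hk']
      have : returnStep h q A x ≤ x + q + 1 := by unfold returnStep; split_ifs <;> linarith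
      linarith
  have hω : ω < 0 := by
    by_contra! h0
    rcases h0.eq_or_lt with h1 | h1
    · exact hC.zero_notMem (h1 ▸ hβω.1)
    · have := hmin ω hβω.1 h1
      linarith [hβω.2.2.1]
  have hωu : u - h ≤ ω := by
    have := hβω.2.2.2 _ (hC.periodic u hu (-1))
    rcases this with h1 | h1 <;> linarith
  have first : returnStep h q A β - returnStep h q A ω = β - ω - 1 := by
    rw [returnStep_low (k := 0) hAh (by linarith) (by linarith),
      returnStep_high (k := -1) hA0 (by linarith) (by linarith)]
    ring
  intro x z H
  constructor
  · by_contra! hlt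
    obtain ⟨v, hv, hlt'⟩ := hC.propagate hβ H.2.1 (fun z => ∃ x, Adj C x z ∧ z - x < β - ω - 1)
      (by
        rintro z y ⟨k, hk⟩ ⟨x, hx, hlt⟩
        obtain rfl : y = z + h * k := by linarith
        exact ⟨_, hx.add hC k, by linarith⟩)
      (by
        rintro z hz hzβ - ⟨w, hw, hlt⟩
        obtain ⟨x, hx⟩ := hC.exists_adj hh hz
        obtain rfl := (hx.step hh hC).unique hw
        exact ⟨x, hx, by linarith [expand x z hx hzβ]⟩)
      ⟨x, H, hlt⟩
    obtain rfl := (hβω.step hh hC).unique hv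
    linarith
  · obtain ⟨w, hw, rfl⟩ := hC.exists_preimage H.2.1
    refine hC.propagate hw hβ (fun z => ∀ x, Adj C x z → z - x ≤ β - ω) ?_ ?_ ?_ x H
    · rintro z y ⟨k, hk⟩ hz x hx
      obtain rfl : y = z + h * k := by linarith
      have := hz (x + h * -k) (by simpa using hx.add hC (-k))
      linarith
    · intro z hz _ hzβ H x hx
      have := H _ (hx.step hh hC)
      linarith [expand x z hx hzβ]
    · intro x hx
      rw [hx.unique hβω]

lemma gap_of_adj (hh : 0 < h) (hC : IsReturnCycle h q A C) {G : ℤ}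
    (H : ∀ x z, Adj C x z → G ≤ z - x) : ∀ x ∈ C, ∀ y ∈ C, x < y → x + G ≤ y := by
  intro x hx y hy hxy
  obtain ⟨w, hw⟩ := hC.exists_adj hh hy
  have h1 := H w y hw
  rcases hw.2.2.2 x hx with h2 | h2 <;> linarith

end IsReturnCycle

end Existence

lemma card_mul_gap_le {G lo : ℤ} (T : Finset ℤ) (gap : ∀ x ∈ T, ∀ y ∈ T, x < y → x + G ≤ y)
    (hT : T.Nonempty) : ∀ hi, (∀ x ∈ T, lo ≤ x ∧ x ≤ hi) → (T.card - 1) * G ≤ hi - lo := by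
  induction T using Finset.induction_on_max with
  | empty => exact absurd hT Finset.not_nonempty_empty
  | insert a s hs ih =>
    intro hi hb
    have ha : a ∉ s := fun h => lt_irrefl _ (hs a h)
    have hba := hb a (Finset.mem_insert_self _ _)
    rcases s.eq_empty_or_nonempty with rfl | hne
    · simp; linarith
    · have := ih (fun x hx y hy => gap x (Finset.mem_insert_of_mem hx) y (Finset.mem_insert_of_mem hy))
        hne (a - G) fun x hx => ⟨(hb x (Finset.mem_insert_of_mem hx)).1, by
          linarith [gap x (Finset.mem_insert_of_mem hx) a (Finset.mem_insert_self _ _) (hs x hx)]⟩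
      rw [Finset.card_insert_of_notMem ha]
      push_cast
      linarith

namespace IsReturnCycle

variable {h q A : ℤ} {C : Set ℤ}

open Classical in
lemma dvd_sum (hh : 0 < h) (hC : IsReturnCycle h q A C) :
    h ∣ ((Finset.Ioo 0 h).filter (· ∈ C)).card * q +
      ((Finset.Ioo 0 h).filter fun x => x ∈ C ∧ A < x).card := by
  set S := (Finset.Ioo 0 h).filter (· ∈ C) with hS
  have mem : ∀ x ∈ C, x % h ∈ S := by
    intro x hx
    have h1 := Int.emod_add_mul_ediv x h
    have h2 := hC.periodic x hx (-(x / h))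
    have h3 : x + h * -(x / h) = x % h := by linarith
    rw [h3] at h2
    have h4 := Int.emod_nonneg x hh.ne'
    have h5 := Int.emod_lt_of_pos x hh
    refine Finset.mem_filter.2 ⟨Finset.mem_Ioo.2 ⟨?_, h5⟩, h2⟩
    rcases h4.eq_or_lt with h6 | h6
    · rw [← h6] at h2; exact absurd h2 hC.zero_notMem
    · exact h6
  have hmem : ∀ x ∈ S, 0 < x ∧ x < h ∧ x ∈ C := by
    intro x hx
    have := Finset.mem_filter.1 hx
    exact ⟨(Finset.mem_Ioo.1 this.1).1, (Finset.mem_Ioo.1 this.1).2, this.2⟩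
  have maps : Set.MapsTo (fun x => returnStep h q A x % h) S S := fun x hx =>
    mem _ (hC.maps _ (hmem x hx).2.2)
  have surj : Set.SurjOn (fun x => returnStep h q A x % h) S S := by
    intro y hy
    obtain ⟨x, hx, e⟩ := hC.exists_preimage (hmem y hy).2.2
    refine ⟨x % h, mem x hx, ?_⟩
    have h1 : x % h = x + h * -(x / h) := by linarith [Int.emod_add_mul_ediv x h]
    simp only [h1, returnStep_add, e, Int.add_mul_emod_self_left]
    exact Int.emod_eq_of_lt (hmem y hy).1.le (hmem y hy).2.1
  have inj := Finset.injOn_of_surjOn_of_card_le _ maps surj le_rfl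
  have hsum : ∑ x ∈ S, returnStep h q A x % h = ∑ x ∈ S, x :=
    Finset.sum_nbij _ maps inj surj fun _ _ => rfl
  have hval : ∑ x ∈ S, returnStep h q A x = ∑ x ∈ S, x + (S.card * q +
      ((Finset.Ioo 0 h).filter fun x => x ∈ C ∧ A < x).card) := by
    have : ∀ x ∈ S, returnStep h q A x = x + (q + if A < x then 1 else 0) := by
      intro x hx
      obtain ⟨h1, h2, -⟩ := hmem x hx
      rw [returnStep, Int.emod_eq_of_lt h1.le h2]
      split_ifs <;> omega
    rw [Finset.sum_congr rfl this, Finset.sum_add_distrib, Finset.sum_add_distrib,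
      Finset.sum_const, ← Finset.sum_filter, Finset.sum_const, hS, Finset.filter_filter]
    simp
  have hdvd : h ∣ ∑ x ∈ S, (returnStep h q A x - returnStep h q A x % h) :=
    Finset.dvd_sum fun x _ => Int.dvd_self_sub_emod
  rwa [Finset.sum_sub_distrib, hsum, hval, add_sub_cancel_left] at hdvd

end IsReturnCycle

/-- If the gcd conditions permit a quasi-path with threshold `A` and it is not a path, then a
return cycle with nearly the same threshold and large gaps exists. -/
theorem absorbing_or_exists_cycle {h q A : ℤ} (hh : 1 < h) (hA0 : 0 ≤ A) (hAh : A < h)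
    (hq : (Int.gcd q h : ℤ) ≤ h - A) (hq1 : (Int.gcd (q + 1) h : ℤ) ≤ A + 1) :
    Absorbing h q A ∨ ∃ (C : Set ℤ) (A' G y : ℤ), IsReturnCycle h q A' C ∧ 1 ∈ C ∧ A' ∈ C ∧
      1 ≤ A' ∧ A' ≤ A ∧ A + 1 - 2 * G ≤ A' ∧ (∀ x ∈ C, ∀ z ∈ C, x < z → x + G ≤ z) ∧ 1 ≤ G ∧
      1 ≤ y ∧ (Int.gcd q h : ℤ) ∣ y ∧ (y - 1) * G + 1 ≤ h - 1 - A ∧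
      (A' = 1 → h ∣ (y + 1) * (q + 1) - 1) := by
  classical
  by_cases H : Absorbing h q A
  · exact Or.inl H
  right
  have hh0 : 0 < h := by linarith
  obtain ⟨C, hC, c, hc⟩ := exists_isReturnCycle hh0 H
  obtain ⟨v, hv, hvA, hvh⟩ := hC.exists_high hh0 hc hq hAh
  obtain ⟨s, hs, hs0, hsA⟩ := hC.exists_low hh0 hc hq1 hA0
  obtain ⟨β, ⟨hβ, hβ0⟩, hβmin⟩ := Int.exists_least_of_bdd (P := fun x => x ∈ C ∧ 0 < x)
    ⟨0, fun x hx => hx.2.le⟩ ⟨s, hs, hs0⟩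
  obtain ⟨u, ⟨hu, hAu⟩, humin⟩ := Int.exists_least_of_bdd (P := fun x => x ∈ C ∧ A < x)
    ⟨A, fun x hx => hx.2.le⟩ ⟨v, hv, hvA⟩
  have huh : u < h := (humin v ⟨hv, hvA⟩).trans_lt hvh
  have hβA : β ≤ A := (hβmin s ⟨hs, hs0⟩).trans hsA
  obtain ⟨ω, hω⟩ := hC.exists_adj hh0 hβ
  obtain ⟨t, ht⟩ := hC.exists_adj hh0 hu
  have gaps := hC.gaps hh0 hA0 hAh hω hβ0 hβA (fun x hx h0 => hβmin x ⟨hx, h0⟩) hu hAu huh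
  have htA : t ≤ A := by
    by_contra! h1
    have := humin t ⟨ht.1, h1⟩
    linarith [ht.2.2.1]
  have hβt : β ≤ t := by
    rcases ht.2.2.2 β hβ with h1 | h1 <;> linarith
  have hω0 : ω < 0 := by
    by_contra! h0
    rcases h0.eq_or_lt with h1 | h1
    · exact hC.zero_notMem (h1 ▸ hω.1)
    · linarith [hβmin ω ⟨hω.1, h1⟩, hω.2.2.1]
  have gap := hC.gap_of_adj hh0 fun x z hxz => (gaps x z hxz).1
  set G := β - ω - 1 with hG
  have hGu := (gaps t u ht).2
  have hG1 : 1 ≤ G := by omega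
  have step : ∀ x, x + (β - 1) ∈ C →
      returnStep h q (t - β + 1) x = returnStep h q A (x + (β - 1)) - (β - 1) := by
    intro x hx
    obtain ⟨k, hk, hk'⟩ := exists_block hh0 (hC.not_dvd hx)
    have h1 : β ≤ x + (β - 1) + h * (-k) := hβmin _ ⟨hC.periodic _ hx _, by linarith⟩
    rcases le_or_gt (x + (β - 1)) (h * k + A) with h2 | h2
    · have h3 : x + (β - 1) + h * (-k) ≤ t := by
        rcases ht.2.2.2 _ (hC.periodic _ hx (-k)) with h3 | h3 <;> linarith
      rw [returnStep_low hAh hk.le h2, returnStep_low (k := k) (by linarith) (by linarith)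
        (by linarith)]
      ring
    · rw [returnStep_high hA0 h2 hk', returnStep_high (k := k) (by linarith) (by linarith)
        (by linarith)]
      ring
  have iter : ∀ (n : ℕ) x, x + (β - 1) ∈ C → (returnStep h q (t - β + 1))^[n] x =
      (returnStep h q A)^[n] (x + (β - 1)) - (β - 1) := by
    intro n
    induction n with
    | zero => intro x _; simp
    | succ n ih =>
      intro x hx
      rw [Function.iterate_succ_apply, step x hx, ih, sub_add_cancel, Function.iterate_succ_apply]
      rw [sub_add_cancel]; exact hC.maps _ hx
  set S := (Finset.Ioo 0 h).filter (· ∈ C) with hS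
  set T := (Finset.Ioo 0 h).filter fun x => x ∈ C ∧ A < x with hT
  have hTmem : ∀ x, x ∈ T ↔ (0 < x ∧ x < h) ∧ x ∈ C ∧ A < x := fun x => by
    rw [hT, Finset.mem_filter, Finset.mem_Ioo]
  have huT : u ∈ T := (hTmem u).2 ⟨⟨by linarith, huh⟩, hu, hAu⟩
  have hdvd : h ∣ S.card * q + T.card := hC.dvd_sum hh0
  have hcard := card_mul_gap_le (G := G) (lo := A + 1) T
    (fun x hx y hy => gap x ((hTmem x).1 hx).2.1 y ((hTmem y).1 hy).2.1) ⟨u, huT⟩ (h - 1)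
    (fun x hx => by have := (hTmem x).1 hx; omega)
  refine ⟨{x | x + (β - 1) ∈ C}, t - β + 1, G, T.card, ⟨?_, ?_, ?_, ?_⟩, ?_, ?_, ?_, ?_, ?_, ?_, hG1,
    ?_, ?_, ?_, ?_⟩
  · intro x hx k
    rw [Set.mem_ofPred_eq, add_right_comm]
    exact hC.periodic _ hx k
  · rw [Set.mem_ofPred_eq, zero_add]
    intro h0
    rcases (show β - 1 = 0 ∨ 0 < β - 1 by omega) with h1 | h1
    · rw [h1] at h0; exact hC.zero_notMem h0
    · linarith [hβmin _ ⟨h0, h1⟩]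
  · intro x hx
    rw [Set.mem_ofPred_eq, step x hx, sub_add_cancel]
    exact hC.maps _ hx
  · intro x hx y hy
    obtain ⟨n, hn⟩ := hC.trans _ hx _ hy
    refine ⟨n, ?_⟩
    rwa [iter n x hx, sub_sub, add_comm (β - 1) y]
  · simpa using hβ
  · rw [Set.mem_ofPred_eq, show t - β + 1 + (β - 1) = t by ring]; exact ht.1
  · linarith
  · linarith
  · have := ht.2.2.1; omega
  · intro x hx y hy hxy
    linarith [gap _ hx _ hy (by linarith)]
  · have : 0 < T.card := Finset.card_pos.2 ⟨u, huT⟩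
    omega
  · have h1 : (Int.gcd q h : ℤ) ∣ S.card * q := (Int.gcd_dvd_left ..).mul_left _
    exact (dvd_add_right h1).1 ((Int.gcd_dvd_right ..).trans hdvd)
  · linarith
  · intro h1
    have e : S = insert β T := by
      ext x
      rw [Finset.mem_insert, hTmem, hS, Finset.mem_filter, Finset.mem_Ioo]
      constructor
      · rintro ⟨⟨h2, h3⟩, h4⟩
        rcases le_or_gt x A with h5 | h5
        · left
          have h6 := hβmin x ⟨h4, h2⟩
          rcases ht.2.2.2 x h4 with h7 | h7 <;> omega
        · exact Or.inr ⟨⟨h2, h3⟩, h4, h5⟩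
      · rintro (rfl | ⟨h2, h4, -⟩)
        · exact ⟨⟨hβ0, by linarith⟩, hβ⟩
        · exact ⟨h2, h4⟩
    have hβT : β ∉ T := fun hm => by linarith [((hTmem β).1 hm).2.2]
    rw [e, Finset.card_insert_of_notMem hβT] at hdvd
    convert hdvd using 1
    push_cast; ring

/-- Compatible thresholds for the return maps with rotation numbers `r` and `s`. -/
def CompatibleThresholds (h r s : ℤ) : Prop := ∃ c d : ℤ, 0 ≤ c ∧ c < h ∧ 0 ≤ d ∧ d < h ∧ c ≤ d + 1 ∧
  d ≤ c + 1 ∧ Absorbing h r (h - 1 - c) ∧ Absorbing h s (h - 1 - d)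

section CompatibleThresholds

variable {h r s : ℤ}

lemma CompatibleThresholds.symm (H : CompatibleThresholds h r s) : CompatibleThresholds h s r := by
  obtain ⟨c, d, h1, h2, h3, h4, h5, h6, h7, h8⟩ := H
  exact ⟨d, c, h3, h4, h1, h2, h6, h5, h8, h7⟩

lemma exists_even_near {n : ℤ} (hn : 0 ≤ n) : ∃ j : ℕ, Even j ∧ (n = j ∨ n = j + 1) :=
  ⟨2 * (n / 2).toNat, even_two_mul _, by omega⟩

lemma gcd_pos_of_pos (hh : 0 < h) : (0 : ℤ) < Int.gcd s h := by
  have : Int.gcd s h ≠ 0 := fun h0 => by have := (Int.gcd_eq_zero_iff.1 h0).2; omega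
  omega

lemma gcd_le_of_pos (hh : 0 < h) : (Int.gcd s h : ℤ) ≤ h :=
  Int.le_of_dvd hh (Int.gcd_dvd_right ..)

lemma two_mul_gcd_le (hh : 0 < h) (hs : ¬ h ∣ s) : 2 * (Int.gcd s h : ℤ) ≤ h := by
  obtain ⟨e, he⟩ : (Int.gcd s h : ℤ) ∣ h := Int.gcd_dvd_right ..
  have h0 := gcd_pos_of_pos (s := s) hh
  have hds : (Int.gcd s h : ℤ) ∣ s := Int.gcd_dvd_left ..
  generalize (Int.gcd s h : ℤ) = d at *
  have h1 : 0 < e := by by_contra! h1; nlinarith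
  rcases (show e = 1 ∨ 2 ≤ e by omega) with rfl | h2
  · rw [mul_one] at he; exact absurd (he ▸ hds) hs
  · nlinarith

lemma gcd_mul_gcd_succ_le (hh : 0 < h) : (Int.gcd r h : ℤ) * Int.gcd (r + 1) h ≤ h := by
  refine Int.le_of_dvd hh (IsCoprime.mul_dvd ?_ (Int.gcd_dvd_right ..) (Int.gcd_dvd_right ..))
  obtain ⟨u, hu⟩ : (Int.gcd r h : ℤ) ∣ r := Int.gcd_dvd_left ..
  obtain ⟨v, hv⟩ : (Int.gcd (r + 1) h : ℤ) ∣ r + 1 := Int.gcd_dvd_left ..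
  exact ⟨-u, v, by linarith⟩

lemma compatible_of_mul_eq_one {τ : ℤ} (hh : 1 < h) (hτ : 1 ≤ τ) (hr : h ∣ τ * r - 1)
    (hs : (Int.gcd s h - 1) * τ < h) : CompatibleThresholds h r s := by
  have h0 := gcd_pos_of_pos (s := s) (show 0 < h by linarith)
  have h1 := gcd_le_of_pos (s := s) (show 0 < h by linarith)
  obtain ⟨j, hj, hjd⟩ := exists_even_near (n := Int.gcd s h - 1) (by linarith)
  have := absorbing_of_gcd (q := s) hh (j := 0) (by simp) (Or.inl rfl)
  refine ⟨j, Int.gcd s h - 1, by positivity, by omega, by linarith, by linarith, by omega, by omega,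
    absorbing_of_mul_eq_one hh hτ hr hj (lt_of_le_of_lt ?_ hs), ?_⟩
  · have : (j : ℤ) ≤ Int.gcd s h - 1 := by omega
    nlinarith
  · convert this using 1; push_cast; ring

lemma compatible_of_dvd (hh : 1 < h) (hr : h ∣ r) (hs : h ∣ s) : CompatibleThresholds h r s := by
  have key : ∀ x, h ∣ x → Absorbing h x (h - 1 - (h - 1)) := by
    intro x hx
    have := absorbing_of_gcd (q := x) hh (j := 0) (by simp) (Or.inl rfl)
    rw [Int.gcd_eq_right (by linarith) hx] at this
    convert this using 1; push_cast; ring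
  exact ⟨h - 1, h - 1, by linarith, by linarith, by linarith, by linarith, by linarith, by linarith,
    key r hr, key s hs⟩

lemma compatible_of_absorbing {c : ℤ} (hh : 1 < h) (H : Absorbing h r (h - 1 - c)) (hch : c < h)
    (hs : ¬ h ∣ s) (h1 : Int.gcd s h - 1 ≤ c) (h2 : c + 3 ≤ 2 * Int.gcd s h) :
    CompatibleThresholds h r s := by
  have h3 := two_mul_gcd_le (by linarith) hs
  obtain ⟨j, hj, hjc⟩ := exists_even_near (n := c - (Int.gcd s h - 1)) (by linarith)
  have := absorbing_of_gcd (q := s) hh hj (Or.inr ⟨by omega, by omega⟩)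
  refine ⟨c, Int.gcd s h - 1 + j, by omega, hch, by omega, by omega, by omega, by omega, H, ?_⟩
  convert this using 1; ring

lemma IsReturnCycle.absorbing_sub_one {h q A : ℤ} {C : Set ℤ} (hh : 0 < h)
    (hC : IsReturnCycle h q A C) (h1 : 1 ∈ C) (hA : A ∈ C) (hA1 : 1 ≤ A) (hAh : A < h) :
    Absorbing h q (A - 1) := by
  have := hC.absorbing (G := 0) hh h1 hA hA1 hAh (fun x _ y _ hxy => by linarith) (j := 0)
    (by simp) (Or.inl rfl)
  simpa using this

set_option maxHeartbeats 400000 in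
/-- The generic case of the choice of compatible thresholds. -/
lemma compatible_or_compatible_succ (hh : 1 < h) (hk : 600 ≤ Int.gcd r h) (hr : ¬ h ∣ r)
    (hs : ¬ h ∣ s) (hr1 : ¬ h ∣ r + 1) (hs1 : ¬ h ∣ s + 1) :
    CompatibleThresholds h r s ∨ (s + 1 ≠ -r ∧ CompatibleThresholds h (r + 1) (s + 1)) := by
  have hh0 : 0 < h := by linarith
  have gr := two_mul_gcd_le hh0 hr
  have gs := two_mul_gcd_le hh0 hs
  have gr1 := two_mul_gcd_le hh0 hr1
  have gs1 := two_mul_gcd_le hh0 hs1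
  have hk' : (600 : ℤ) ≤ Int.gcd r h := by exact_mod_cast hk
  rcases le_or_gt (Int.gcd r h : ℤ) (Int.gcd s h) with hle | hlt
  · left
    rcases absorbing_or_exists_cycle (q := r) (A := h - Int.gcd s h) hh (by linarith) (by linarith)
      (by linarith) (by linarith) with H | ⟨C, A', G, y, hC, h1, hA', h1A, hAA, hAG, hgap, hG,
        hy, hdy, hyG, -⟩
    · refine compatible_of_absorbing (c := Int.gcd s h - 1) hh ?_ (by linarith) hs le_rfl (by linarith)
      convert H using 1; ring
    · have hy' := Int.le_of_dvd (by linarith) hdy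
      have : 599 * G ≤ (y - 1) * G := mul_le_mul_of_nonneg_right (by linarith) (by linarith)
      refine compatible_of_absorbing (c := h - A') hh ?_ (by linarith) hs (by linarith) (by linarith)
      convert hC.absorbing_sub_one hh0 h1 hA' h1A (by linarith) using 1; ring
  · rcases absorbing_or_exists_cycle (q := s) (A := h - Int.gcd r h) hh (by linarith) (by linarith)
      (by linarith) (by linarith) with H | ⟨C, A', G, y, hC, h1, hA', h1A, hAA, hAG, hgap, hG,
        hy, hdy, hyG, hone⟩
    · refine Or.inl (compatible_of_absorbing (c := Int.gcd r h - 1) hh ?_ (by linarith) hr le_rfl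
        (by linarith)).symm
      convert H using 1; ring
    have hS := hC.absorbing_sub_one hh0 h1 hA' h1A (by linarith)
    rcases le_or_gt (h - A' + 3) (2 * Int.gcd r h) with hc | hc
    · refine Or.inl (compatible_of_absorbing (c := h - A') hh ?_ (by linarith) hr (by linarith) hc).symm
      convert hS using 1; ring
    have hG300 : 300 ≤ G := by omega
    have hprod := gcd_mul_gcd_succ_le (r := r) hh0
    have hd1 := gcd_pos_of_pos (s := r + 1) hh0
    have hprod' : 600 * (Int.gcd (r + 1) h : ℤ) ≤ h :=
      (mul_le_mul_of_nonneg_right hk' hd1.le).trans hprod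
    rcases h1A.lt_or_eq with hA1 | hA1
    · left
      have hAG' := hgap 1 h1 A' hA' hA1
      rcases absorbing_or_exists_cycle (q := r) (A := A' - 1) hh (by linarith) (by linarith)
        (by linarith) (by linarith) with H | ⟨C₂, A₂, G₂, y₂, hC₂, h1₂, hA₂, h1A₂, hAA₂, hAG₂, -, hG₂,
          hy₂, hdy₂, hyG₂, -⟩
      · refine ⟨h - A', h - A', by linarith, by linarith, by linarith, by linarith, by linarith,
          by linarith, ?_, ?_⟩
        · convert H using 1; ring
        · convert hS using 1; ring
      · have hy' := Int.le_of_dvd (by linarith) hdy₂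
        have : 599 * G₂ ≤ (y₂ - 1) * G₂ :=
          mul_le_mul_of_nonneg_right (by linarith) (by linarith)
        obtain ⟨j, hj, hjc⟩ := exists_even_near (n := A' - A₂) (by linarith)
        have hjG : (j : ℤ) + 2 ≤ G := by omega
        refine ⟨h - A₂, h - A' + j, by linarith, by linarith, by omega, by omega, by omega,
          by omega, ?_, ?_⟩
        · convert hC₂.absorbing_sub_one hh0 h1₂ hA₂ h1A₂ (by linarith) using 1; ring
        · convert hC.absorbing hh0 h1 hA' h1A (by linarith) hgap hj (Or.inr ⟨hjG, hA1⟩) using 1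
          ring
    · right
      have hdvd := hone hA1.symm
      have hy2 : y ≤ 2 := by
        by_contra! h3
        have : 2 * G ≤ (y - 1) * G := mul_le_mul_of_nonneg_right (by linarith) (by linarith)
        linarith
      refine ⟨fun e => ?_, (compatible_of_mul_eq_one (τ := y + 1) hh (by linarith) hdvd ?_).symm⟩
      · rw [e] at hdvd
        have h2 : (Int.gcd r h : ℤ) ∣ (y + 1) * -r :=
          ((Int.gcd_dvd_left ..).neg_right).mul_left _
        have h3 := (dvd_sub_right h2).1 ((Int.gcd_dvd_right ..).trans hdvd)
        have := Int.le_of_dvd one_pos h3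
        linarith
      · have : (Int.gcd (r + 1) h - 1) * (y + 1) ≤ (Int.gcd (r + 1) h - 1) * 3 :=
          mul_le_mul_of_nonneg_left (by linarith) (by linarith)
        linarith

/-- Compatible thresholds exist for some distribution of the full cosets. -/
theorem exists_compatible_of_left {q₁ q₂ m : ℤ} (hh : 1 < h) (hm : 1 ≤ m) (hq : q₁ + q₂ = -m)
    (hm1 : m = 1 → ¬ h ∣ q₁ ∧ ¬ h ∣ q₂) (hk : 600 ≤ Int.gcd q₁ h) :
    ∃ p, 0 ≤ p ∧ p < m ∧ CompatibleThresholds h (q₁ + p) (q₂ + p) := by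
  have hh0 : 0 < h := by linarith
  by_cases hdeg : ∃ p, 0 ≤ p ∧ p ≤ m ∧ h ∣ q₁ + p
  · obtain ⟨p, hp0, hpm, hp⟩ := hdeg
    have hp2 : h ∣ q₂ + (m - p) := by
      rwa [show q₂ + (m - p) = -(q₁ + p) by linarith, dvd_neg]
    rcases (show p + 2 ≤ m ∨ 2 ≤ p ∨ m = 1 ∨ (m = 2 ∧ p = 1) by omega) with h1 | h1 | h1 | ⟨h1, h2⟩
    · refine ⟨p + 1, by linarith, by linarith,
        compatible_of_mul_eq_one (τ := 1) hh le_rfl (by convert hp using 1; ring) ?_⟩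
      linarith [gcd_le_of_pos (s := q₂ + (p + 1)) hh0]
    · refine ⟨m - p + 1, by linarith, by linarith,
        (compatible_of_mul_eq_one (τ := 1) hh le_rfl (by convert hp2 using 1; ring) ?_).symm⟩
      linarith [gcd_le_of_pos (s := q₁ + (m - p + 1)) hh0]
    · obtain ⟨h2, h3⟩ := hm1 h1
      rcases (show p = 0 ∨ p = 1 by omega) with rfl | rfl
      · exact absurd (by simpa using hp) h2
      · exact absurd (by simpa [h1] using hp2) h3
    · subst h1 h2
      exact ⟨1, by norm_num, by norm_num, compatible_of_dvd hh hp (by convert hp2 using 1; norm_num)⟩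
  · push Not at hdeg
    rcases compatible_or_compatible_succ (s := q₂) hh hk
      (by simpa using hdeg 0 le_rfl (by linarith))
      (fun hd => hdeg m (by linarith) le_rfl (by
        rwa [show q₁ + m = -q₂ by linarith, dvd_neg]))
      (hdeg 1 (by norm_num) hm)
      (fun hd => hdeg (m - 1) (by linarith) (by linarith) (by
        rwa [show q₁ + (m - 1) = -(q₂ + 1) by linarith, dvd_neg])) with H | ⟨h1, H⟩
    · exact ⟨0, le_rfl, by linarith, by simpa using H⟩
    · refine ⟨1, by norm_num, ?_, H⟩
      rcases (show m = 1 ∨ 1 < m by omega) with h2 | h2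
      · exact absurd (by linarith) h1
      · exact h2

theorem exists_compatible {q₁ q₂ m : ℤ} (hh : 1 < h) (hm : 1 ≤ m) (hq : q₁ + q₂ = -m)
    (hm1 : m = 1 → ¬ h ∣ q₁ ∧ ¬ h ∣ q₂) (hk : 600 ≤ Int.gcd q₁ h ∨ 600 ≤ Int.gcd q₂ h) :
    ∃ p, 0 ≤ p ∧ p < m ∧ CompatibleThresholds h (q₁ + p) (q₂ + p) := by
  rcases hk with hk | hk
  · exact exists_compatible_of_left hh hm hq hm1 hk
  · obtain ⟨p, h1, h2, H⟩ := exists_compatible_of_left hh hm (by rwa [add_comm])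
      (fun h => (hm1 h).symm) hk
    exact ⟨p, h1, h2, H.symm⟩

end CompatibleThresholds

/-- A self-map all of whose orbits end at `t` and which is injective away from `t` enumerates the
whole set along a single orbit. -/
lemma exists_enumeration {X : Type*} [Fintype X] (S : X → X) (t : X)
    (reach : ∀ x, ∃ n : ℕ, S^[n] x = t) (inj : ∀ x y, x ≠ t → y ≠ t → S x = S y → x = y) :
    ∃ v : Fin (Fintype.card X) → X, Function.Bijective v ∧
      ∀ (i : ℕ) (h : i + 1 < Fintype.card X),
        v ⟨i + 1, h⟩ = S (v ⟨i, Nat.lt_of_succ_lt h⟩) ∧ v ⟨i, Nat.lt_of_succ_lt h⟩ ≠ t := by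
  classical
  let d : X → ℕ := fun x => Nat.find (reach x)
  have hd0 : ∀ x, d x = 0 → x = t := by
    intro x hx
    have := Nat.find_spec (reach x)
    change S^[d x] x = t at this
    rwa [hx] at this
  have hdt : d t = 0 := (Nat.find_eq_zero _).2 rfl
  have hd1 : ∀ x n, d x = n + 1 → d (S x) = n := by
    intro x n hx
    refine (Nat.find_eq_iff _).2 ⟨?_, fun k hk e => ?_⟩
    · have := Nat.find_spec (reach x)
      change S^[d x] x = t at this
      rwa [hx, Function.iterate_succ_apply] at this
    · exact Nat.find_min (reach x) (show k + 1 < d x by omega)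
        (by rwa [Function.iterate_succ_apply])
  have hne : ∀ x n, d x = n + 1 → x ≠ t := by
    rintro x n hx rfl
    omega
  have dinj : ∀ n x y, d x = n → d y = n → x = y := by
    intro n
    induction n with
    | zero => intro x y hx hy; rw [hd0 x hx, hd0 y hy]
    | succ n ih =>
      intro x y hx hy
      exact inj x y (hne x n hx) (hne y n hy) (ih _ _ (hd1 x n hx) (hd1 y n hy))
  have down : ∀ k n x, d x = k + n → ∃ y, d y = n := by
    intro k
    induction k with
    | zero => intro n x hx; exact ⟨x, by omega⟩
    | succ k ih => intro n x hx; exact ih n (S x) (hd1 x _ (by omega))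
  have hlt : ∀ x, d x < Fintype.card X := by
    intro x
    have hsub : Finset.range (d x + 1) ⊆ Finset.univ.image d := by
      intro n hn
      obtain ⟨y, hy⟩ := down (d x - n) n x (by have := Finset.mem_range.1 hn; omega)
      exact Finset.mem_image.2 ⟨y, Finset.mem_univ _, hy⟩
    have := (Finset.card_le_card hsub).trans Finset.card_image_le
    rw [Finset.card_range, Finset.card_univ] at this
    omega
  let e : X → Fin (Fintype.card X) := fun x => ⟨Fintype.card X - 1 - d x, by have := hlt x; omega⟩
  have hebij : Function.Bijective e := by
    rw [Fintype.bijective_iff_injective_and_card]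
    refine ⟨fun x y hxy => dinj (d x) x y rfl ?_, by simp⟩
    have h1 := congrArg Fin.val hxy
    have := hlt x
    have := hlt y
    simp only [e] at h1
    omega
  let E := Equiv.ofBijective e hebij
  have hE : ∀ i, d (E.symm i) = Fintype.card X - 1 - i := by
    intro i
    have h1 : e (E.symm i) = i := E.apply_symm_apply i
    have h2 := congrArg Fin.val h1
    have := hlt (E.symm i)
    simp only [e] at h2
    omega
  refine ⟨E.symm, E.symm.bijective, fun i hi => ?_⟩
  have h1 : d (E.symm ⟨i, Nat.lt_of_succ_lt hi⟩) = (Fintype.card X - 1 - (i + 1)) + 1 := by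
    rw [hE]; simp only; omega
  exact ⟨dinj _ _ _ (hE _) (hd1 _ _ h1), hne _ _ h1⟩

/-- Coordinates `(i, x) ↦ i • a + x • δ` on an abelian group: `i` ranges over `0, …, m - 1`, and
`x` is taken modulo `h`. -/
structure IsFrame {G : Type*} [AddCommGroup G] (a δ : G) (h m f : ℤ) : Prop where
  h_pos : 0 < h
  m_pos : 0 < m
  exists_coord : ∀ v, ∃ i x : ℤ, 0 ≤ i ∧ i < m ∧ v = i • a + x • δ
  coord_unique : ∀ i x j y : ℤ, 0 ≤ i → i < m → 0 ≤ j → j < m →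
    i • a + x • δ = j • a + y • δ → i = j ∧ h ∣ x - y
  period : h • δ = 0
  wrap : m • a = f • δ

section Frame

variable {G : Type*} [AddCommGroup G]

/-- Whether the quasi-path leaves `v` along `a + δ` rather than `a`: decided by `P` outside the
subgroup `⟨δ⟩`, and by a threshold relative to the endpoint `τ • δ` inside it. -/
def UsesSecond (a δ : G) (h m : ℤ) (P : ℤ → Prop) (A τ : ℤ) (v : G) : Prop :=
  ∃ i x : ℤ, 0 ≤ i ∧ i < m ∧ v = i • a + x • δ ∧ (i = 0 → A < (x - τ) % h) ∧ (i ≠ 0 → P i)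

open Classical in
/-- The successor map of a quasi-path. -/
noncomputable def pathSucc (a δ : G) (h m : ℤ) (P : ℤ → Prop) (A τ : ℤ) (v : G) : G :=
  if UsesSecond a δ h m P A τ v then v + (a + δ) else v + a

namespace IsFrame

variable {a δ : G} {h m f A τ : ℤ} {P : ℤ → Prop}

lemma usesSecond_iff (F : IsFrame a δ h m f) {i : ℤ} (x : ℤ) (h0 : 0 ≤ i) (h1 : i < m) :
    UsesSecond a δ h m P A τ (i • a + x • δ) ↔
      (i = 0 → A < (x - τ) % h) ∧ (i ≠ 0 → P i) := by
  constructor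
  · rintro ⟨j, y, h2, h3, e, H⟩
    obtain ⟨rfl, k, hk⟩ := F.coord_unique _ _ _ _ h0 h1 h2 h3 e
    have : x - τ = (y - τ) + h * k := by linarith
    rwa [this, Int.add_mul_emod_self_left]
  · intro H
    exact ⟨i, x, h0, h1, rfl, H⟩

lemma pathSucc_zero (F : IsFrame a δ h m f) (x : ℤ) :
    pathSucc a δ h m P A τ (x • δ) =
      (1 : ℤ) • a + (if (x - τ) % h ≤ A then x else x + 1) • δ := by
  have := F.usesSecond_iff (P := P) (A := A) (τ := τ) x le_rfl F.m_pos
  rw [zero_smul, zero_add] at this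
  simp only [forall_const, ne_eq, not_true_eq_false, false_imp_iff, and_true] at this
  unfold pathSucc
  split_ifs with h1 h2 h2
  · exact absurd (this.1 h1) (not_lt.2 h2)
  · module
  · module
  · exact absurd (this.2 (not_le.1 h2)) h1

open Classical in
lemma pathSucc_pos (F : IsFrame a δ h m f) {i : ℤ} (x : ℤ) (h0 : 0 < i) (h1 : i < m) :
    pathSucc a δ h m P A τ (i • a + x • δ) =
      (i + 1) • a + (x + if P i then 1 else 0) • δ := by
  have := F.usesSecond_iff (P := P) (A := A) (τ := τ) x h0.le h1
  simp only [h0.ne', false_imp_iff, ne_eq, not_false_eq_true, forall_const, true_and] at this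
  unfold pathSucc
  rw [if_congr this rfl rfl]
  split_ifs <;> module

open Classical in
lemma exists_iterate_eq (F : IsFrame a δ h m f) {c : ℤ → ℤ} (cm : c m = 0)
    (cs : ∀ i, 0 < i → i < m → c i = c (i + 1) + if P i then 1 else 0)
    (H : Absorbing h (f + c 1) A) (v : G) :
    ∃ n : ℕ, (pathSucc a δ h m P A τ)^[n] v = τ • δ := by
  set S := pathSucc a δ h m P A τ with hS
  let R : G → Prop := fun v => ∃ n : ℕ, S^[n] v = τ • δ
  have hR : ∀ v, R (S v) → R v := by
    rintro v ⟨n, hn⟩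
    exact ⟨n + 1, by rwa [Function.iterate_succ_apply]⟩
  have climb : ∀ (n : ℕ) (i x : ℤ), 0 < i → i + n = m → R ((f + x + c i) • δ) →
      R (i • a + x • δ) := by
    intro n
    induction n with
    | zero =>
      intro i x h0 hi hr
      have hi' : i = m := by simpa using hi
      subst hi'
      rw [F.wrap, ← add_smul]
      simpa [cm] using hr
    | succ n ih =>
      intro i x h0 hi hr
      have him : i < m := by push_cast at hi; omega
      refine hR _ ?_
      rw [hS, F.pathSucc_pos x h0 him]
      refine ih _ _ (by omega) (by push_cast at hi; omega) ?_
      rw [cs i h0 him] at hr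
      convert hr using 2
      ring
  have climb' : ∀ i x : ℤ, 0 < i → i ≤ m → R ((f + x + c i) • δ) → R (i • a + x • δ) :=
    fun i x h0 hi => climb (m - i).toNat i x h0 (by omega)
  have base : ∀ (n : ℕ) (u : ℤ), h ∣ (returnStep h (f + c 1) A)^[n] u → R ((u + τ) • δ) := by
    intro n
    induction n with
    | zero =>
      rintro u ⟨k, hk⟩
      rw [Function.iterate_zero_apply] at hk
      refine ⟨0, ?_⟩
      rw [Function.iterate_zero_apply, hk, add_smul, mul_comm, mul_smul, F.period, smul_zero,
        zero_add]
    | succ n ih =>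
      intro u hu
      rw [Function.iterate_succ_apply] at hu
      refine hR _ ?_
      rw [hS, F.pathSucc_zero]
      refine climb' _ _ one_pos F.m_pos ?_
      convert ih _ hu using 2
      rw [add_sub_cancel_right, returnStep]
      split_ifs <;> ring
  have zero : ∀ x : ℤ, R (x • δ) := by
    intro x
    obtain ⟨n, hn⟩ := H (x - τ)
    simpa using base n _ hn
  obtain ⟨i, x, h0, h1, rfl⟩ := F.exists_coord v
  rcases h0.eq_or_lt with rfl | h2
  · simpa using zero x
  · exact climb' i x h2 h1.le (zero _)

lemma pathSucc_inj (F : IsFrame a δ h m f) :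
    ∀ v w, v ≠ τ • δ → w ≠ τ • δ → pathSucc a δ h m P A τ v = pathSucc a δ h m P A τ w →
      v = w := by
  have key : ∀ v w, v ≠ τ • δ → ¬ UsesSecond a δ h m P A τ v → UsesSecond a δ h m P A τ w →
      v + a ≠ w + (a + δ) := by
    intro v w hv h1 h2 e
    obtain ⟨i, x, hi0, him, rfl⟩ := F.exists_coord w
    have hv' : v = i • a + (x + 1) • δ := by
      have : v = i • a + x • δ + (a + δ) - a := eq_sub_of_add_eq e
      rw [this]; module
    subst hv'
    rw [F.usesSecond_iff _ hi0 him] at h1 h2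
    refine h1 ⟨fun hi => ?_, h2.2⟩
    by_contra! h3
    have h4 := h2.1 hi
    subst hi
    refine hv ?_
    have hh := F.h_pos
    have h5 := Int.emod_add_mul_ediv (x + 1 - τ) h
    have h6 := Int.emod_nonneg (x + 1 - τ) hh.ne'
    have h7 := Int.emod_lt_of_pos (x + 1 - τ) hh
    rcases h6.eq_or_lt with h8 | h8
    · have : x + 1 = τ + (x + 1 - τ) / h * h := by linarith
      rw [this, zero_smul, zero_add, add_smul, mul_smul, F.period, smul_zero, add_zero]
    · rw [emod_eq_sub (x := x - τ) (k := (x + 1 - τ) / h) (by linarith) (by linarith)] at h4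
      linarith
  intro v w hv hw e
  unfold pathSucc at e
  split_ifs at e with h1 h2 h2
  · exact add_right_cancel e
  · exact absurd e.symm (key w v hw h2 h1)
  · exact absurd e (key v w hv h1 h2)
  · exact add_right_cancel e

open Classical in
lemma exists_hamPath [Fintype G] (F : IsFrame a δ h m f) {c : ℤ → ℤ} (cm : c m = 0)
    (cs : ∀ i, 0 < i → i < m → c i = c (i + 1) + if P i then 1 else 0)
    (H : Absorbing h (f + c 1) A) :
    ∃ v : Fin (Fintype.card G) → G, IsHamPath a (a + δ) (Fintype.card G) v ∧
      ∀ p ∈ ArcSet (Fintype.card G) v, p.2 = pathSucc a δ h m P A τ p.1 ∧ p.1 ≠ τ • δ := by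
  obtain ⟨v, hv, hs⟩ := exists_enumeration (pathSucc a δ h m P A τ) (τ • δ)
    (F.exists_iterate_eq cm cs H) F.pathSucc_inj
  refine ⟨v, ⟨hv, fun i hi => ?_⟩, ?_⟩
  · rw [(hs i hi).1, pathSucc]
    split_ifs <;> simp
  · rintro p ⟨i, hi, rfl⟩
    exact hs i hi

end IsFrame

end Frame

/-- Two thresholds `h - 1 - c` and `d` with `|c - d| ≤ 1` admit endpoints `0` and `τ` such that
the corresponding quasi-paths make opposite choices away from these endpoints. -/
lemma exists_opposite_offset {h c d : ℤ} (hc0 : 0 ≤ c) (hc : c < h) (hcd : c ≤ d + 1)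
    (hdc : d ≤ c + 1) :
    ∃ τ : ℤ, ∀ x : ℤ, ¬ h ∣ x → ¬ h ∣ x - τ →
      (h - 1 - c < x % h ↔ ¬ d < (x - τ) % h) := by
  have key : ∀ τ, (τ = h - 1 - c ∧ c ≤ d ∨ τ = h - c ∧ c = d + 1) → ∀ x : ℤ, ¬ h ∣ x →
      ¬ h ∣ x - τ → (h - 1 - c < x % h ↔ ¬ d < (x - τ) % h) := by
    intro τ hτ x hx hxτ
    have hh : 0 < h := by omega
    have h0 := Int.emod_nonneg x hh.ne'
    have h1 := Int.emod_lt_of_pos x hh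
    have h2 := Int.emod_add_mul_ediv x h
    have h3 : x % h ≠ 0 := fun e => hx (Int.dvd_of_emod_eq_zero e)
    have h4 : x % h ≠ τ := by
      intro e
      exact hxτ ⟨x / h, by linarith⟩
    have h8 : 0 ≤ τ ∧ τ ≤ h := by omega
    rcases lt_or_gt_of_ne h4 with h5 | h5
    · have h6 : (x - τ) % h = x - τ - h * (x / h - 1) :=
        emod_eq_sub (by linarith) (by linarith)
      have h7 : (x - τ) % h = x % h - τ + h := by linarith
      rw [h7]
      clear h6 h7
      generalize x % h = r at *
      omega
    · have h6 : (x - τ) % h = x - τ - h * (x / h) := emod_eq_sub (by linarith) (by omega)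
      have h7 : (x - τ) % h = x % h - τ := by linarith
      rw [h7]
      clear h6 h7
      generalize x % h = r at *
      omega
  rcases (show c ≤ d ∨ c = d + 1 by omega) with H | H
  · exact ⟨_, key _ (Or.inl ⟨rfl, H⟩)⟩
  · exact ⟨_, key _ (Or.inr ⟨rfl, H⟩)⟩

section Frame

variable {G : Type*} [AddCommGroup G] {a δ : G} {h m f : ℤ}

lemma IsFrame.exists_arc_disjoint [Fintype G] (F : IsFrame a δ h m f) (hδ : δ ≠ 0) {p : ℤ}
    (hp0 : 0 ≤ p) (hpm : p < m) (H : CompatibleThresholds h (f + p) (-(f + m) + p)) :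
    ∃ v v' : Fin (Fintype.card G) → G,
      IsHamPath a (a + δ) (Fintype.card G) v ∧ IsHamPath a (a + δ) (Fintype.card G) v' ∧
      Disjoint (ArcSet (Fintype.card G) v) (ArcSet (Fintype.card G) v') := by
  obtain ⟨c, d, hc0, hc, hd0, hd, hcd, hdc, H1, H2⟩ := H
  have H3 : Absorbing h (f + (m - 1 - p)) d := by
    have := H2.neg F.h_pos (by omega) (by omega)
    rwa [show h - 1 - (h - 1 - d) = d by ring,
      show -(-(f + m) + p) - 1 = f + (m - 1 - p) by ring] at this
  obtain ⟨τ, hτ⟩ := exists_opposite_offset hc0 hc hcd hdc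
  have hm := F.m_pos
  obtain ⟨v, hv, hva⟩ := F.exists_hamPath (P := fun i => i ≤ p) (A := h - 1 - c) (τ := 0)
    (c := fun i => max 0 (p + 1 - i)) (by omega)
    (by intro i h0 h1; split_ifs <;> omega)
    (by
      convert H1 using 2
      omega)
  obtain ⟨v', hv', hva'⟩ := F.exists_hamPath (P := fun i => p < i) (A := d) (τ := τ)
    (c := fun i => min (m - i) (m - 1 - p)) (by omega)
    (by intro i h0 h1; split_ifs <;> omega)
    (by
      convert H3 using 2
      omega)
  refine ⟨v, v', hv, hv', Set.disjoint_left.2 fun e he he' => ?_⟩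
  obtain ⟨h1, h2⟩ := hva e he
  obtain ⟨h3, h4⟩ := hva' e he'
  rw [h1] at h3
  obtain ⟨i, x, hi0, him, hx⟩ := F.exists_coord e.1
  have hopp : UsesSecond a δ h m (fun i => i ≤ p) (h - 1 - c) 0 e.1 ↔
      ¬ UsesSecond a δ h m (fun i => p < i) d τ e.1 := by
    rw [hx, F.usesSecond_iff x hi0 him, F.usesSecond_iff x hi0 him]
    rcases hi0.eq_or_lt with rfl | hi
    · have hne : ∀ t : ℤ, e.1 ≠ t • δ → ¬ h ∣ x - t := by
        rintro t ht ⟨k, hk⟩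
        refine ht ?_
        rw [hx, show x = t + k * h by linarith, add_smul, mul_smul, F.period]
        simp
      simpa using hτ x (by simpa using hne 0 h2) (hne τ h4)
    · simp [hi.ne']
  unfold pathSucc at h3
  split_ifs at h3 with h5 h6 h6
  · exact hopp.1 h5 h6
  · exact hδ (by simpa using h3)
  · exact hδ (by simpa using h3)
  · exact h5 (hopp.2 h6)

lemma exists_isFrame [Finite G] (hδ : δ ≠ 0)
    (hspan : ∀ v : G, ∃ i x : ℤ, v = i • a + x • δ) :
    ∃ h m f : ℤ, 1 < h ∧ IsFrame a δ h m f := by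
  have hh : 0 < addOrderOf δ := addOrderOf_pos δ
  have hh1 : addOrderOf δ ≠ 1 := fun e => hδ (AddMonoid.addOrderOf_eq_one_iff.1 e)
  have hm : 0 < addOrderOf (a : G ⧸ AddSubgroup.zmultiples δ) := addOrderOf_pos _
  have hmem : ∀ i : ℤ, i • a ∈ AddSubgroup.zmultiples δ ↔
      (addOrderOf (a : G ⧸ AddSubgroup.zmultiples δ) : ℤ) ∣ i := by
    intro i
    rw [addOrderOf_dvd_iff_zsmul_eq_zero, ← QuotientAddGroup.mk_zsmul,
      QuotientAddGroup.eq_zero_iff]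
  set m : ℤ := (addOrderOf (a : G ⧸ AddSubgroup.zmultiples δ) : ℤ) with hmdef
  obtain ⟨f, hf⟩ := AddSubgroup.mem_zmultiples_iff.1 ((hmem m).2 dvd_rfl)
  refine ⟨(addOrderOf δ : ℤ), m, f, by omega, ⟨by omega, by omega, fun v => ?_, ?_, ?_, hf.symm⟩⟩
  · obtain ⟨i, x, rfl⟩ := hspan v
    refine ⟨i % m, x + i / m * f, Int.emod_nonneg _ (by omega), Int.emod_lt_of_pos _ (by omega), ?_⟩
    rw [add_smul, mul_smul, hf, smul_smul]
    nth_rw 1 [← Int.emod_add_mul_ediv i m]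
    rw [add_smul, mul_comm]
    abel
  · intro i x j y hi him hj hjm e
    have e1 : (i - j) • a = (y - x) • δ := by
      rw [sub_smul, sub_smul, sub_eq_sub_iff_add_eq_add, e]
      abel
    have h1 : m ∣ i - j := (hmem _).1 (AddSubgroup.mem_zmultiples_iff.2 ⟨_, e1.symm⟩)
    have h2 : i = j := by
      have := Int.eq_zero_of_abs_lt_dvd h1 (abs_lt.2 ⟨by omega, by omega⟩)
      omega
    subst h2
    refine ⟨rfl, ?_⟩
    rw [addOrderOf_dvd_iff_zsmul_eq_zero, ← neg_sub y x, neg_smul, ← e1]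
    simp
  · rw [natCast_zsmul, addOrderOf_nsmul_eq_zero]

lemma index_zmultiples_le {c : G} (hspan : ∀ v : G, ∃ i x : ℤ, v = i • c + x • δ) {g : ℕ}
    (hg : g ≠ 0) (hmem : (g : ℤ) • δ ∈ AddSubgroup.zmultiples c) :
    (AddSubgroup.zmultiples c).index ≤ g := by
  have htop : ∀ w : G ⧸ AddSubgroup.zmultiples c,
      w ∈ AddSubgroup.zmultiples (δ : G ⧸ AddSubgroup.zmultiples c) := by
    intro w
    obtain ⟨v, rfl⟩ := QuotientAddGroup.mk_surjective w
    obtain ⟨i, x, rfl⟩ := hspan v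
    refine AddSubgroup.mem_zmultiples_iff.2 ⟨x, ?_⟩
    rw [← QuotientAddGroup.mk_zsmul, QuotientAddGroup.eq]
    exact AddSubgroup.mem_zmultiples_iff.2 ⟨i, by abel⟩
  rw [AddSubgroup.index, ← addOrderOf_eq_card_of_forall_mem_zmultiples htop]
  refine Nat.le_of_dvd (Nat.pos_of_ne_zero hg) (addOrderOf_dvd_of_nsmul_eq_zero ?_)
  rw [← QuotientAddGroup.mk_nsmul, QuotientAddGroup.eq_zero_iff]
  simpa using hmem

lemma index_zmultiples_le_gcd {c : G} (hspan : ∀ v : G, ∃ i x : ℤ, v = i • c + x • δ) {q : ℤ}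
    (hh : h ≠ 0) (hδ : h • δ = 0) (hq : q • δ ∈ AddSubgroup.zmultiples c) :
    (AddSubgroup.zmultiples c).index ≤ Int.gcd q h := by
  refine index_zmultiples_le hspan (fun e => hh (Int.gcd_eq_zero_iff.1 e).2) ?_
  rw [Int.gcd_eq_gcd_ab, add_smul, mul_comm h, mul_smul _ h, hδ, smul_zero, add_zero, mul_comm,
    mul_smul]
  exact AddSubgroup.zsmul_mem _ hq _

lemma exists_arc_disjoint_of_index [Fintype G] (hδ : δ ≠ 0) (ha : a ≠ 0) (hb : a + δ ≠ 0)
    (hspan : ∀ v : G, ∃ i x : ℤ, v = i • a + x • δ)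
    (hidx : 600 ≤ (AddSubgroup.zmultiples a).index ∨
      600 ≤ (AddSubgroup.zmultiples (a + δ)).index) :
    ∃ v v' : Fin (Fintype.card G) → G,
      IsHamPath a (a + δ) (Fintype.card G) v ∧ IsHamPath a (a + δ) (Fintype.card G) v' ∧
      Disjoint (ArcSet (Fintype.card G) v) (ArcSet (Fintype.card G) v') := by
  obtain ⟨h, m, f, hh, F⟩ := exists_isFrame hδ hspan
  have hspan' : ∀ v : G, ∃ i x : ℤ, v = i • (a + δ) + x • δ := by
    intro v
    obtain ⟨i, x, rfl⟩ := hspan v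
    exact ⟨i, x - i, by module⟩
  have hw : (f + m) • δ = m • (a + δ) := by rw [smul_add, F.wrap, add_smul]
  have hdvd : ∀ q : ℤ, h ∣ q → q • δ = 0 := by
    rintro q ⟨k, rfl⟩
    rw [mul_comm, mul_smul, F.period, smul_zero]
  obtain ⟨p, hp0, hpm, H⟩ := exists_compatible (q₁ := f) (q₂ := -(f + m)) hh F.m_pos (by ring)
    (by
      rintro rfl
      refine ⟨fun hf => ha ?_, fun hf => hb ?_⟩
      · rw [← one_zsmul a, F.wrap, hdvd f hf]
      · rw [← one_zsmul (a + δ), ← hw, hdvd _ ((dvd_neg).1 hf)])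
    (hidx.imp
      (fun hi => hi.trans (index_zmultiples_le_gcd hspan (by omega) F.period
        (AddSubgroup.mem_zmultiples_iff.2 ⟨m, F.wrap⟩)))
      (fun hi => hi.trans (index_zmultiples_le_gcd hspan' (by omega) F.period
        (AddSubgroup.mem_zmultiples_iff.2 ⟨-m, by rw [neg_smul, neg_smul, hw]⟩))))
  exact F.exists_arc_disjoint hδ hp0 hpm H

end Frame

/-- If `{a, b}` generates the finite abelian group `G`, with `a, b ≠ 0`, and
`[G : ⟨a⟩] ≥ 600` or `[G : ⟨b⟩] ≥ 600`, then `Cay(G; a, b)` has two arc-disjoint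
hamiltonian paths. -/
theorem arc_disjoint_of_large_index {G : Type*} [AddCommGroup G] [Fintype G]
    (a b : G) (hab : a ≠ b) (ha : a ≠ 0) (hb : b ≠ 0)
    (hgen : AddSubgroup.closure {a, b} = ⊤)
    (hidx : 600 ≤ (AddSubgroup.zmultiples a).index ∨
            600 ≤ (AddSubgroup.zmultiples b).index) :
    ∃ v v' : Fin (Fintype.card G) → G,
      IsHamPath a b (Fintype.card G) v ∧ IsHamPath a b (Fintype.card G) v' ∧
      Disjoint (ArcSet (Fintype.card G) v) (ArcSet (Fintype.card G) v') := by
  obtain ⟨δ, rfl⟩ : ∃ δ, b = a + δ := ⟨b - a, by abel⟩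
  refine exists_arc_disjoint_of_index (fun e => hab (by simp [e])) ha hb (fun v => ?_) hidx
  have hv : v ∈ AddSubgroup.closure {a, a + δ} := hgen ▸ AddSubgroup.mem_top v
  obtain ⟨i, j, rfl⟩ := AddSubgroup.mem_closure_pair.1 hv
  exact ⟨i + j, j, by module⟩
end

section
/- Let G be an abelian group (possibly infinite) and let a, b ∈ G with a ≠ b. Suppose f : G → G is a bijection such that f(x) − x ∈ {a, b} for every x ∈ G. Then for every g ∈ G, either f(x) = x + a for all x in the coset g + ⟨a − b⟩, or f(x) = x + b for all x in the coset g + ⟨a − b⟩. -/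
/-- Travelling by `a` is invariant under translation by `a - b`: injectivity of `f` propagates it
forwards, surjectivity propagates it backwards. -/
theorem travels_add_sub_iff {G : Type*} [AddCommGroup G] {a b : G} (hab : a ≠ b)
    {f : G → G} (hf : Function.Bijective f)
    (hstep : ∀ x : G, f x = x + a ∨ f x = x + b) (x : G) :
    f (x + (a - b)) = x + (a - b) + a ↔ f x = x + a := by
  have hd : a - b ≠ 0 := sub_ne_zero.mpr hab
  constructor
  · intro h
    obtain ⟨y, hy⟩ := hf.2 (x + a)
    rcases hstep y with hya | hyb
    · have hyx : y = x := add_right_cancel (hya.symm.trans hy)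
      rwa [hyx] at hy
    · have hyx : y = x + (a - b) := by
        rw [← add_sub_assoc, eq_sub_iff_add_eq, ← hyb, hy]
      rw [hyx, h] at hy
      exact absurd (add_eq_left.mp (add_right_cancel hy)) hd
  · intro h
    refine (hstep (x + (a - b))).resolve_right fun h' => hd ?_
    have heq : f (x + (a - b)) = f x := by rw [h', h]; abel
    exact add_eq_left.mp (hf.1 heq)

/-- Travelling by `a` is invariant under translation by integer multiples of `a - b`. -/
theorem travels_add_zsmul_iff {G : Type*} [AddCommGroup G] {a b : G} (hab : a ≠ b)
    {f : G → G} (hf : Function.Bijective f)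
    (hstep : ∀ x : G, f x = x + a ∨ f x = x + b) (x : G) (n : ℤ) :
    f (x + n • (a - b)) = x + n • (a - b) + a ↔ f x = x + a := by
  induction n with
  | zero => simp
  | succ n ih =>
    rw [add_zsmul, one_zsmul, ← add_assoc, travels_add_sub_iff hab hf hstep]
    exact ih
  | pred n ih =>
    rw [← ih, ← travels_add_sub_iff hab hf hstep (x + (-(n : ℤ) - 1) • (a - b)),
      sub_zsmul, one_zsmul, add_assoc x, neg_add_cancel_right]

/-- If `f : G → G` is a bijection of an abelian group with `f x − x ∈ {a, b}` for all
`x`, then each coset of `⟨a − b⟩` either travels by `a` or travels by `b`. -/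
theorem coset_travels {G : Type*} [AddCommGroup G] (a b : G) (hab : a ≠ b)
    (f : G → G) (hf : Function.Bijective f)
    (hstep : ∀ x : G, f x - x ∈ ({a, b} : Set G)) (g : G) :
    (∀ x : G, x - g ∈ AddSubgroup.zmultiples (a - b) → f x = x + a) ∨
    (∀ x : G, x - g ∈ AddSubgroup.zmultiples (a - b) → f x = x + b) := by
  have hstep' : ∀ x : G, f x = x + a ∨ f x = x + b := fun x => by
    simpa [sub_eq_iff_eq_add'] using hstep x
  have htravel : ∀ x : G, x - g ∈ AddSubgroup.zmultiples (a - b) →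
      (f x = x + a ↔ f g = g + a) := by
    intro x hx
    obtain ⟨n, hn⟩ := AddSubgroup.mem_zmultiples_iff.mp hx
    obtain rfl : x = g + n • (a - b) := by rw [hn, add_sub_cancel]
    exact travels_add_zsmul_iff hab hf hstep' g n
  by_cases hg : f g = g + a
  · exact Or.inl fun x hx => (htravel x hx).mpr hg
  · exact Or.inr fun x hx => (hstep' x).resolve_left fun h => hg ((htravel x hx).mp h)
end

section
/- Let G be an infinite abelian group generated by a 2-element set {a, b}, and let I = [G : ⟨a − b⟩] be the index of the subgroup generated by a − b. Then Cay(G; a, b) has two arc-disjoint two-way infinite hamiltonian paths if and only if I is finite and there exist integers k, ℓ with 0 ≤ k, ℓ ≤ I, k + ℓ = I, and ⟨a − b⟩ = ⟨k·a + ℓ·b⟩ = ⟨ℓ·a + k·b⟩. -/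
/-- `v : ℤ → G` is a two-way infinite hamiltonian path of the Cayley digraph
`Cay(G; a, b)`. -/
def IsZHamPath {G : Type*} [AddCommGroup G] (a b : G) (v : ℤ → G) : Prop :=
  Function.Bijective v ∧ ∀ i : ℤ, v (i + 1) - v i ∈ ({a, b} : Set G)

/-- The arc set of a two-way infinite path. -/
def ZArcSet {G : Type*} (v : ℤ → G) : Set (G × G) :=
  {p | ∃ i : ℤ, p = (v i, v (i + 1))}

section CayleyCosets

variable {G : Type*} [AddCommGroup G] {a b : G}

theorem exists_sub_zsmul_mem_zmultiples_sub (hgen : AddSubgroup.closure {a, b} = ⊤) (g : G) :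
    ∃ n : ℤ, g - n • b ∈ AddSubgroup.zmultiples (a - b) := by
  have hg : g ∈ AddSubgroup.closure {a, b} := hgen ▸ AddSubgroup.mem_top g
  obtain ⟨m, n, rfl⟩ := AddSubgroup.mem_closure_pair.mp hg
  refine ⟨m + n, AddSubgroup.mem_zmultiples_iff.mpr ⟨m, ?_⟩⟩
  module

theorem zsmul_mem_zmultiples_sub_iff (hgen : AddSubgroup.closure {a, b} = ⊤) (n : ℤ) :
    n • b ∈ AddSubgroup.zmultiples (a - b) ↔
      ((AddSubgroup.zmultiples (a - b)).index : ℤ) ∣ n := by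
  have hcyc : ∀ x : G ⧸ AddSubgroup.zmultiples (a - b),
      x ∈ AddSubgroup.zmultiples (b : G ⧸ AddSubgroup.zmultiples (a - b)) := by
    intro x
    induction x using QuotientAddGroup.induction_on with
    | H g =>
      obtain ⟨n, hn⟩ := exists_sub_zsmul_mem_zmultiples_sub hgen g
      refine AddSubgroup.mem_zmultiples_iff.mpr ⟨n, ?_⟩
      rw [← QuotientAddGroup.mk_zsmul, QuotientAddGroup.eq, neg_add_eq_sub]
      exact hn
  rw [AddSubgroup.index, ← addOrderOf_eq_card_of_forall_mem_zmultiples hcyc,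
    addOrderOf_dvd_iff_zsmul_eq_zero, ← QuotientAddGroup.mk_zsmul,
    QuotientAddGroup.eq_zero_iff]

theorem map_add_zsmul_of_periodic_step {v : ℤ → G} {p : ℤ} {d : G}
    (h : ∀ i, v (i + p) = v i + d) (i n : ℤ) : v (i + n * p) = v i + n • d := by
  induction n using Int.induction_on with
  | zero => simp
  | succ n ih =>
    rw [show i + ((n : ℤ) + 1) * p = i + n * p + p by ring, h, ih]
    module
  | pred n ih =>
    have := h (i + (-(n : ℤ) - 1) * p)
    rw [show i + (-(n : ℤ) - 1) * p + p = i + -(n : ℤ) * p by ring, ih] at this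
    rw [← sub_eq_iff_eq_add.mpr this]
    module

theorem map_add_of_step {v : ℤ → G} {d : G} (h : ∀ i, v (i + 1) = v i + d) (i n : ℤ) :
    v (i + n) = v i + n • d := by
  simpa using map_add_zsmul_of_periodic_step h i n

theorem sub_sub_zsmul_mem_zmultiples_sub {v : ℤ → G}
    (hv : ∀ i, v (i + 1) - v i ∈ ({a, b} : Set G)) (i j : ℤ) :
    v i - v j - (i - j) • b ∈ AddSubgroup.zmultiples (a - b) := by
  have hstep : ∀ i, (v (i + 1) : G ⧸ AddSubgroup.zmultiples (a - b)) = v i + b := by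
    intro i
    rw [← QuotientAddGroup.mk_add, QuotientAddGroup.eq, AddSubgroup.mem_zmultiples_iff]
    rcases hv i with h | h
    · exact ⟨-1, by rw [sub_eq_iff_eq_add'.mp h]; module⟩
    · exact ⟨0, by rw [sub_eq_iff_eq_add'.mp h]; module⟩
  have := map_add_of_step (v := fun i => (v i : G ⧸ AddSubgroup.zmultiples (a - b))) hstep j (i - j)
  simp only [add_sub_cancel] at this
  rw [← QuotientAddGroup.eq_zero_iff]
  simp [this]

theorem sub_mem_zmultiples_sub_iff (hgen : AddSubgroup.closure {a, b} = ⊤) {v : ℤ → G}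
    (hv : ∀ i, v (i + 1) - v i ∈ ({a, b} : Set G)) (i j : ℤ) :
    v i - v j ∈ AddSubgroup.zmultiples (a - b) ↔
      ((AddSubgroup.zmultiples (a - b)).index : ℤ) ∣ i - j := by
  rw [← zsmul_mem_zmultiples_sub_iff hgen]
  have h := sub_sub_zsmul_mem_zmultiples_sub hv i j
  exact ⟨fun h' => by simpa using sub_mem h' h, fun h' => by simpa using add_mem h h'⟩

theorem exists_sub_apply_mem_zmultiples_sub (hgen : AddSubgroup.closure {a, b} = ⊤) {v : ℤ → G}
    (hv : ∀ i, v (i + 1) - v i ∈ ({a, b} : Set G)) (g : G) :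
    ∃ n : ℤ, g - v n ∈ AddSubgroup.zmultiples (a - b) := by
  obtain ⟨n, hn⟩ := exists_sub_zsmul_mem_zmultiples_sub hgen (g - v 0)
  refine ⟨n, ?_⟩
  have := sub_mem hn (sub_sub_zsmul_mem_zmultiples_sub hv n 0)
  convert this using 1
  module

theorem exists_add_nsmul_of_steps {v : ℤ → G}
    (hv : ∀ i, v (i + 1) - v i ∈ ({a, b} : Set G)) (i : ℤ) (n : ℕ) :
    ∃ k l : ℕ, k + l = n ∧ v (i + n) = v i + (k • a + l • b) := by
  induction n with
  | zero => exact ⟨0, 0, by simp⟩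
  | succ n ih =>
    obtain ⟨k, l, hkl, h⟩ := ih
    push_cast
    rw [← add_assoc]
    rcases hv (i + n) with h' | h'
    · refine ⟨k + 1, l, by omega, ?_⟩
      rw [sub_eq_iff_eq_add'.mp h', h]
      module
    · refine ⟨k, l + 1, by omega, ?_⟩
      rw [sub_eq_iff_eq_add'.mp (Set.mem_singleton_iff.mp h'), h]
      module

theorem zmultiples_eq_of_surjective (hgen : AddSubgroup.closure {a, b} = ⊤) {v : ℤ → G} {d : G}
    (hv : ∀ i, v (i + 1) - v i ∈ ({a, b} : Set G)) (hsurj : Function.Surjective v)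
    (hd : ∀ i, v (i + (AddSubgroup.zmultiples (a - b)).index) = v i + d) :
    AddSubgroup.zmultiples (a - b) = AddSubgroup.zmultiples d := by
  apply le_antisymm <;> rw [AddSubgroup.zmultiples_le]
  · obtain ⟨i, hi⟩ := hsurj (v 0 + (a - b))
    have hmem : v i - v 0 ∈ AddSubgroup.zmultiples (a - b) := by
      rw [hi, add_sub_cancel_left]
      exact AddSubgroup.mem_zmultiples _
    obtain ⟨m, hm⟩ := (sub_mem_zmultiples_sub_iff hgen hv i 0).mp hmem
    have := map_add_zsmul_of_periodic_step hd 0 m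
    rw [mul_comm, ← hm, add_sub_cancel, hi, add_right_inj] at this
    exact AddSubgroup.mem_zmultiples_iff.mpr ⟨m, this.symm⟩
  · have := (sub_mem_zmultiples_sub_iff hgen hv
      (0 + (AddSubgroup.zmultiples (a - b)).index) 0).mpr (by simp)
    rwa [hd, add_sub_cancel_left] at this

theorem isZHamPath_of_zmultiples_eq [Infinite G] (hgen : AddSubgroup.closure {a, b} = ⊤)
    {v : ℤ → G} {d : G} (hv : ∀ i, v (i + 1) - v i ∈ ({a, b} : Set G))
    (hI : (AddSubgroup.zmultiples (a - b)).index ≠ 0)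
    (hd : ∀ i, v (i + (AddSubgroup.zmultiples (a - b)).index) = v i + d)
    (heq : AddSubgroup.zmultiples (a - b) = AddSubgroup.zmultiples d) : IsZHamPath a b v := by
  have hinf : addOrderOf d = 0 := by
    rw [← Nat.card_zmultiples, ← heq]
    have := (AddSubgroup.zmultiples (a - b)).card_mul_index
    rw [Nat.card_eq_zero_of_infinite (α := G)] at this
    exact (mul_eq_zero.mp this).resolve_right hI
  refine ⟨⟨fun i j hij => ?_, fun g => ?_⟩, hv⟩
  · obtain ⟨m, hm⟩ := (sub_mem_zmultiples_sub_iff hgen hv i j).mp (by simp [hij])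
    have := map_add_zsmul_of_periodic_step hd j m
    rw [mul_comm, ← hm, add_sub_cancel, hij, left_eq_add,
      ← addOrderOf_dvd_iff_zsmul_eq_zero, hinf] at this
    have hm0 : m = 0 := by simpa using this
    rw [hm0, mul_zero] at hm
    omega
  · obtain ⟨n, hn⟩ := exists_sub_apply_mem_zmultiples_sub hgen hv g
    rw [heq, AddSubgroup.mem_zmultiples_iff] at hn
    obtain ⟨m, hm⟩ := hn
    exact ⟨_, by rw [map_add_zsmul_of_periodic_step hd n m, hm, add_sub_cancel]⟩

namespace IsZHamPath

variable {v v' : ℤ → G}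

theorem step_eq_iff_of_apply_eq_add_sub (hv : IsZHamPath a b v) (hab : a ≠ b) {i j : ℤ}
    (hij : v j = v i + (a - b)) : v (i + 1) = v i + a ↔ v (j + 1) = v j + a := by
  have hne : i ≠ j := by
    rintro rfl
    rw [left_eq_add, sub_eq_zero] at hij
    exact hab hij
  constructor
  · intro hi
    rcases hv.2 j with h | h
    · exact sub_eq_iff_eq_add'.mp h
    · refine absurd (hv.1.1 (a₁ := i + 1) (a₂ := j + 1) ?_) (by simpa using hne)
      rw [hi, sub_eq_iff_eq_add'.mp (Set.mem_singleton_iff.mp h), hij]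
      module
  · intro hj
    obtain ⟨m, hm⟩ := hv.1.2 (v i + a)
    rcases hv.2 (m - 1) with h | h <;>
      rw [sub_add_cancel, hm] at h
    · have : v (m - 1) = v i := by
        rw [← sub_eq_zero, ← sub_eq_zero.mpr h.symm]
        module
      rw [← hv.1.1 this, sub_add_cancel, hm, hv.1.1 this]
    · have hmj : v (m - 1) = v j := by
        rw [hij, ← sub_eq_zero, ← sub_eq_zero.mpr (Set.mem_singleton_iff.mp h).symm]
        module
      rw [← hv.1.1 hmj, sub_add_cancel, hm, hmj, hij] at hj
      exact absurd hj (by simpa [sub_eq_zero] using hab)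

theorem step_eq_iff_of_sub_mem (hv : IsZHamPath a b v) (hab : a ≠ b) {i j : ℤ}
    (hij : v j - v i ∈ AddSubgroup.zmultiples (a - b)) :
    v (i + 1) = v i + a ↔ v (j + 1) = v j + a := by
  obtain ⟨n, hn⟩ := AddSubgroup.mem_zmultiples_iff.mp hij
  rw [eq_sub_iff_add_eq'] at hn
  induction n using Int.induction_on generalizing j with
  | zero => rw [hv.1.1 (show v j = v i by simpa using hn.symm)]
  | succ n ih =>
    obtain ⟨m, hm⟩ := hv.1.2 (v i + (n : ℤ) • (a - b))
    rw [ih (j := m) (by simp [hm]) hm.symm]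
    exact hv.step_eq_iff_of_apply_eq_add_sub hab (by rw [← hn, hm]; module)
  | pred n ih =>
    obtain ⟨m, hm⟩ := hv.1.2 (v i + -(n : ℤ) • (a - b))
    rw [ih (j := m) (by simp [hm]) hm.symm]
    exact (hv.step_eq_iff_of_apply_eq_add_sub hab (by rw [← hn, hm]; module)).symm

theorem step_eq_of_sub_mem (hv : IsZHamPath a b v) (hab : a ≠ b) {i j : ℤ}
    (hij : v j - v i ∈ AddSubgroup.zmultiples (a - b)) :
    v (i + 1) - v i = v (j + 1) - v j := by
  have h := hv.step_eq_iff_of_sub_mem hab hij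
  rw [← sub_eq_iff_eq_add', ← sub_eq_iff_eq_add'] at h
  rcases hv.2 i with hi | hi
  · rw [h.mp hi, hi]
  · rcases hv.2 j with hj | hj
    · rw [h.mpr hj, hj]
    · exact hi.trans hj.symm

theorem exists_forall_apply_add_index (hv : IsZHamPath a b v) (hab : a ≠ b)
    (hgen : AddSubgroup.closure {a, b} = ⊤) :
    ∃ d, ∀ i, v (i + (AddSubgroup.zmultiples (a - b)).index) = v i + d := by
  set I := (AddSubgroup.zmultiples (a - b)).index with hI
  refine ⟨v (0 + I) - v 0, fun i => ?_⟩
  have key := map_add_of_step (v := fun i => v (i + I) - v i) (d := 0) (fun i => by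
    have h := hv.step_eq_of_sub_mem hab (i := i) (j := i + I)
      ((sub_mem_zmultiples_sub_iff hgen hv.2 _ _).mpr (by simp [hI]))
    rw [add_zero, sub_eq_sub_iff_sub_eq_sub, show i + 1 + (I : ℤ) = i + I + 1 by ring]
    exact h.symm) 0 i
  simp only [smul_zero, add_zero, zero_add] at key
  rw [zero_add, ← key]
  abel

theorem index_ne_zero (hv : IsZHamPath a b v) (hab : a ≠ b)
    (hgen : AddSubgroup.closure {a, b} = ⊤) : (AddSubgroup.zmultiples (a - b)).index ≠ 0 := by
  intro hI
  obtain ⟨i, hi⟩ := hv.1.2 (v 0 + (a - b))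
  have h := (sub_mem_zmultiples_sub_iff hgen hv.2 i 0).mp
    (by rw [hi, add_sub_cancel_left]; exact AddSubgroup.mem_zmultiples _)
  rw [hI, Nat.cast_zero, zero_dvd_iff, sub_zero] at h
  rw [h, left_eq_add, sub_eq_zero] at hi
  exact hab hi

theorem step_add_step_of_disjoint (hv : IsZHamPath a b v) (hv' : IsZHamPath a b v')
    (hdisj : Disjoint (ZArcSet v) (ZArcSet v')) {i j : ℤ} (hij : v i = v' j) :
    (v (i + 1) - v i) + (v' (j + 1) - v' j) = a + b := by
  have hne : v (i + 1) - v i ≠ v' (j + 1) - v' j := by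
    intro h
    rw [hij, sub_left_inj] at h
    exact Set.disjoint_left.mp hdisj ⟨i, rfl⟩ ⟨j, by rw [hij, h]⟩
  rcases hv.2 i with h | h <;> rcases hv'.2 j with h' | h' <;>
    rw [h, h'] at hne ⊢ <;> first | exact absurd rfl hne | exact add_comm _ _

theorem exists_zmultiples_eq (hv : IsZHamPath a b v) (hv' : IsZHamPath a b v') (hab : a ≠ b)
    (hgen : AddSubgroup.closure {a, b} = ⊤) (hdisj : Disjoint (ZArcSet v) (ZArcSet v')) :
    ∃ k l : ℕ, k + l = (AddSubgroup.zmultiples (a - b)).index ∧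
      AddSubgroup.zmultiples (a - b) = AddSubgroup.zmultiples (k • a + l • b) ∧
      AddSubgroup.zmultiples (a - b) = AddSubgroup.zmultiples (l • a + k • b) := by
  set I := (AddSubgroup.zmultiples (a - b)).index with hI
  obtain ⟨d, hd⟩ := hv.exists_forall_apply_add_index hab hgen
  obtain ⟨d', hd'⟩ := hv'.exists_forall_apply_add_index hab hgen
  rw [← hI] at hd hd'
  obtain ⟨k, l, hkl, hdkl⟩ := exists_add_nsmul_of_steps hv.2 0 I
  rw [hd, add_right_inj] at hdkl
  obtain ⟨j, hj⟩ := hv.1.2 (v' 0)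
  have hstep : ∀ i, v (i + 1 + j) + v' (i + 1) = v (i + j) + v' i + (a + b) := by
    intro i
    obtain ⟨m, hm⟩ := hv.1.2 (v' i)
    have hmem : v (i + j) - v m ∈ AddSubgroup.zmultiples (a - b) := by
      have h := sub_mem (sub_sub_zsmul_mem_zmultiples_sub hv.2 (i + j) j)
        (sub_sub_zsmul_mem_zmultiples_sub hv'.2 i 0)
      convert h using 1
      rw [hm, hj]
      module
    have h := hv.step_add_step_of_disjoint hv' hdisj hm
    rw [hv.step_eq_of_sub_mem hab hmem] at h
    rw [← h, show i + 1 + j = i + j + 1 by ring]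
    abel
  have hsum := map_add_of_step (v := fun i => v (i + j) + v' i) hstep 0 I
  simp only [zero_add] at hsum
  have hd'lk : d' = l • a + k • b := by
    have h0 := hd' 0
    rw [zero_add] at h0
    rw [add_comm (I : ℤ) j, hd, h0, hdkl, ← hkl] at hsum
    have : d' = ((k + l : ℕ) : ℤ) • (a + b) - (k • a + l • b) := by
      rw [eq_sub_iff_add_eq, ← add_right_inj (v j + v' 0), ← hsum]
      abel
    rw [this]
    push_cast
    module
  subst hdkl hd'lk
  exact ⟨k, l, hkl, zmultiples_eq_of_surjective hgen hv.2 hv.1.2 hd,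
    zmultiples_eq_of_surjective hgen hv'.2 hv'.1.2 hd'⟩

end IsZHamPath

/-- The number of `j` in `[0, i)` with `j % p < k`, extended to negative `i`. -/
def periodicCount (p k i : ℤ) : ℤ := i / p * k + min (i % p) k

theorem periodicCount_add_self {p : ℤ} (hp : p ≠ 0) (k i : ℤ) :
    periodicCount p k (i + p) = periodicCount p k i + k := by
  rw [periodicCount, periodicCount, Int.add_emod_right, Int.add_ediv_of_dvd_right dvd_rfl,
    Int.ediv_self hp]
  ring

theorem periodicCount_succ {p k : ℤ} (hp : 0 < p) (hk : 0 ≤ k) (hkp : k ≤ p) (i : ℤ) :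
    periodicCount p k (i + 1) = periodicCount p k i ∨
      periodicCount p k (i + 1) = periodicCount p k i + 1 := by
  have h0 := Int.emod_nonneg i hp.ne'
  have h1 := Int.emod_lt_of_pos i hp
  have h2 := Int.emod_add_mul_ediv i p
  rcases eq_or_lt_of_le (Int.add_one_le_iff.mpr h1) with h | h
  · have hi : i + 1 = 0 + p * (i / p + 1) := by linarith
    have hq : (i + 1) / p = i / p + 1 := by
      rw [hi, Int.add_mul_ediv_left _ _ hp.ne', Int.zero_ediv, zero_add]
    have hr : (i + 1) % p = 0 := by
      rw [hi, Int.add_mul_emod_self_left, Int.zero_emod]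
    rw [periodicCount, periodicCount, hq, hr, add_mul, one_mul]
    omega
  · have hi : i + 1 = (i % p + 1) + p * (i / p) := by linarith
    have hq : (i + 1) / p = i / p := by
      rw [hi, Int.add_mul_ediv_left _ _ hp.ne', Int.ediv_eq_zero_of_lt (by omega) h, zero_add]
    have hr : (i + 1) % p = i % p + 1 := by
      rw [hi, Int.add_mul_emod_self_left, Int.emod_eq_of_lt (by omega) h]
    rw [periodicCount, periodicCount, hq, hr]
    omega

theorem exists_disjoint_isZHamPath [Infinite G] (hab : a ≠ b)
    (hgen : AddSubgroup.closure {a, b} = ⊤) (hI : (AddSubgroup.zmultiples (a - b)).index ≠ 0)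
    {k l : ℕ} (hkl : k + l = (AddSubgroup.zmultiples (a - b)).index)
    (h₁ : AddSubgroup.zmultiples (a - b) = AddSubgroup.zmultiples (k • a + l • b))
    (h₂ : AddSubgroup.zmultiples (a - b) = AddSubgroup.zmultiples (l • a + k • b)) :
    ∃ v v' : ℤ → G, IsZHamPath a b v ∧ IsZHamPath a b v' ∧
      Disjoint (ZArcSet v) (ZArcSet v') := by
  set I := (AddSubgroup.zmultiples (a - b)).index with hIdef
  have hI' : (I : ℤ) ≠ 0 := by exact_mod_cast hI
  have hcast : (I : ℤ) = k + l := by exact_mod_cast hkl.symm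
  let A : ℤ → ℤ := periodicCount I k
  have hper : ∀ i, A (i + I) = A i + k := periodicCount_add_self hI' k
  have hsucc : ∀ i, A (i + 1) = A i ∨ A (i + 1) = A i + 1 :=
    periodicCount_succ (by omega) (by omega) (by omega)
  let v : ℤ → G := fun i => A i • a + (i - A i) • b
  let v' : ℤ → G := fun i => (i - A i) • a + A i • b
  have hv : ∀ i, v (i + 1) - v i ∈ ({a, b} : Set G) := by
    intro i
    rcases hsucc i with h | h <;> simp only [v, h]
    · right; rw [Set.mem_singleton_iff]; module
    · left; module
  have hv' : ∀ i, v' (i + 1) - v' i ∈ ({a, b} : Set G) := by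
    intro i
    rcases hsucc i with h | h <;> simp only [v', h]
    · left; module
    · right; rw [Set.mem_singleton_iff]; module
  refine ⟨v, v', isZHamPath_of_zmultiples_eq hgen hv hI (fun i => ?_) h₁,
    isZHamPath_of_zmultiples_eq hgen hv' hI (fun i => ?_) h₂, ?_⟩
  · rw [← hIdef]
    simp only [v, hper]
    rw [hcast]
    module
  · rw [← hIdef]
    simp only [v', hper]
    rw [hcast]
    module
  · rw [Set.disjoint_left]
    rintro _ ⟨i, rfl⟩ ⟨j, hj⟩
    obtain ⟨hij, hij'⟩ := Prod.mk.inj hj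
    have hmem : v i - v j ∈ AddSubgroup.zmultiples (a - b) := by
      refine AddSubgroup.mem_zmultiples_iff.mpr ⟨j - A j - A j, ?_⟩
      rw [hij]
      simp only [v, v']
      module
    obtain ⟨m, hm⟩ := (sub_mem_zmultiples_sub_iff hgen hv i j).mp hmem
    have hA : ∀ t, A (t + m * I) = A t + m * k := fun t => by
      simpa using map_add_zsmul_of_periodic_step hper t m
    have hi : i = j + m * I := by linarith
    have hstep : A (i + 1) - A i = A (j + 1) - A j := by
      rw [hi, show j + m * I + 1 = j + 1 + m * I by ring, hA, hA]
      ring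
    have hdiff : v (i + 1) - v i = v' (j + 1) - v' j := by rw [hij, hij']
    apply hab
    rw [← sub_eq_zero]
    rcases hsucc j with h | h
    · have h' : A (i + 1) = A i := by linarith
      simp only [v, v', h, h'] at hdiff
      rw [← sub_eq_zero.mpr hdiff.symm]
      module
    · have h' : A (i + 1) = A i + 1 := by linarith
      simp only [v, v', h, h'] at hdiff
      rw [← sub_eq_zero.mpr hdiff]
      module

end CayleyCosets

/-- Let `G` be an infinite abelian group generated by `{a, b}` and let
`I = [G : ⟨a − b⟩]`. Then `Cay(G; a, b)` has two arc-disjoint two-way infinite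
hamiltonian paths iff `I` is finite and there are `k, ℓ ≥ 0` with `k + ℓ = I` and
`⟨a − b⟩ = ⟨k·a + ℓ·b⟩ = ⟨ℓ·a + k·b⟩`.
(In Mathlib, `AddSubgroup.index` is `0` when the index is infinite.) -/
theorem arc_disjoint_two_way_infinite_iff {G : Type*} [AddCommGroup G] [Infinite G]
    (a b : G) (hab : a ≠ b) (hgen : AddSubgroup.closure {a, b} = ⊤) :
    (∃ v v' : ℤ → G, IsZHamPath a b v ∧ IsZHamPath a b v' ∧
        Disjoint (ZArcSet v) (ZArcSet v')) ↔
      ((AddSubgroup.zmultiples (a - b)).index ≠ 0 ∧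
        ∃ k l : ℕ, k + l = (AddSubgroup.zmultiples (a - b)).index ∧
          AddSubgroup.zmultiples (a - b) = AddSubgroup.zmultiples (k • a + l • b) ∧
          AddSubgroup.zmultiples (a - b) = AddSubgroup.zmultiples (l • a + k • b)) := by
  constructor
  · rintro ⟨v, v', hv, hv', hdisj⟩
    exact ⟨hv.index_ne_zero hab hgen, hv.exists_zmultiples_eq hv' hab hgen hdisj⟩
  · rintro ⟨hI, k, l, hkl, h₁, h₂⟩
    exact exists_disjoint_isZHamPath hab hgen hI hkl h₁ h₂
end
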